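/- Assume N ≥ 3 and 1 + 4/(N−2) < p ≤ 1 + 4/(N−3) (for N = 3 this means p > 5). There exists a constant C = C(N,p) > 0 with the following property: if σ > 1 and u ∈ C²([0,σ)) is a solution of (PDE) on (0,σ) with u(0) ≥ C, then u is positive and extends to a positive analytic solution of (PDE) on (0,+∞); furthermore there exists L > 0 such that ρ^α u(ρ) → L and ρ^{α+1} u′(ρ) → −αL as ρ → +∞. -/

import Mathlib

open Set Filter

noncomputable def alphaP (p : ℝ) : ℝ := 2 / (p - 1)

noncomputable def b0 (p : ℝ) : ℝ := (2 * (p + 1) / (p - 1) ^ 2) ^ ((1 : ℝ) / (p - 1))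

noncomputable def bInf (N : ℕ) (p : ℝ) : ℝ :=
  (alphaP p * ((N : ℝ) - 2 - alphaP p)) ^ (alphaP p / 2)

noncomputable def uInf (N : ℕ) (p : ℝ) (ρ : ℝ) : ℝ := bInf N p * ρ ^ (-(alphaP p))

/-- `u` solves `(1-ρ²)u'' + ((N-1)/ρ - 2(α+1)ρ)u' - α(α+1)u + |u|^{p-1}u = 0` on `s`. -/
def IsSolOn (N : ℕ) (p : ℝ) (u : ℝ → ℝ) (s : Set ℝ) : Prop :=
  ∀ ρ ∈ s,
    (1 - ρ ^ 2) * deriv (deriv u) ρ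
      + (((N : ℝ) - 1) / ρ - 2 * (alphaP p + 1) * ρ) * deriv u ρ
      - alphaP p * (alphaP p + 1) * u ρ + |u ρ| ^ (p - 1) * u ρ = 0

/-- The weighted average `∫₀¹ t^κ f(tz) dt` of `f` along the ray from `0` to `z`. -/
noncomputable def rayAvg (κ : ℝ) (f : ℂ → ℂ) (z : ℂ) : ℂ :=
  ∫ t in (0 : ℝ)..1, ((t ^ κ : ℝ) : ℂ) * f (t * z)

lemma norm_rayAvg_le {κ : ℝ} (hκ : 0 ≤ κ) {f : ℂ → ℂ} {z : ℂ} {M : ℝ}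
    (h : ∀ t ∈ Icc (0 : ℝ) 1, ‖f (t * z)‖ ≤ M) : ‖rayAvg κ f z‖ ≤ M := by
  have := intervalIntegral.norm_integral_le_of_norm_le_const (a := 0) (b := 1) (C := M)
    (f := fun t : ℝ => ((t ^ κ : ℝ) : ℂ) * f (t * z)) ?_
  · simpa [rayAvg] using this
  · intro t ht
    rw [uIoc_of_le zero_le_one] at ht
    have h1 : ‖f (t * z)‖ ≤ M := h t ⟨ht.1.le, ht.2⟩
    have h2 : |t ^ κ| ≤ 1 := by
      rw [abs_of_nonneg (Real.rpow_nonneg ht.1.le _)]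
      exact Real.rpow_le_one ht.1.le ht.2 hκ
    rw [norm_mul, Complex.norm_real, Real.norm_eq_abs]
    calc |t ^ κ| * ‖f (t * z)‖ ≤ 1 * ‖f (t * z)‖ := by gcongr
      _ ≤ M := by simpa using h1

lemma continuous_ofReal_rpow {κ : ℝ} (hκ : 0 ≤ κ) :
    Continuous fun t : ℝ => ((t ^ κ : ℝ) : ℂ) :=
  Complex.continuous_ofReal.comp (Real.continuous_rpow_const hκ)

lemma intervalIntegrable_rayAvg {κ : ℝ} (hκ : 0 ≤ κ) {f : ℂ → ℂ} {z : ℂ}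
    (h : ContinuousOn (fun t : ℝ => f (t * z)) (Icc 0 1)) :
    IntervalIntegrable (fun t : ℝ => ((t ^ κ : ℝ) : ℂ) * f (t * z)) MeasureTheory.volume 0 1 := by
  apply ContinuousOn.intervalIntegrable
  rw [uIcc_of_le zero_le_one]
  exact (continuous_ofReal_rpow hκ).continuousOn.mul h

lemma norm_rayAvg_sub_le {κ : ℝ} (hκ : 0 ≤ κ) {f g : ℂ → ℂ} {z : ℂ} {d : ℝ}
    (hf : ContinuousOn (fun t : ℝ => f (t * z)) (Icc 0 1))
    (hg : ContinuousOn (fun t : ℝ => g (t * z)) (Icc 0 1))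
    (h : ∀ t ∈ Icc (0 : ℝ) 1, ‖f (t * z) - g (t * z)‖ ≤ d) :
    ‖rayAvg κ f z - rayAvg κ g z‖ ≤ d := by
  have : rayAvg κ f z - rayAvg κ g z = rayAvg κ (fun y => f y - g y) z := by
    unfold rayAvg
    rw [← intervalIntegral.integral_sub (intervalIntegrable_rayAvg hκ hf)
      (intervalIntegrable_rayAvg hκ hg)]
    congr 1; ext t; ring
  rw [this]
  exact norm_rayAvg_le hκ h

lemma ofReal_mul_mem_ball {r : ℝ} {z : ℂ} (hz : z ∈ Metric.ball (0 : ℂ) r) {t : ℝ}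
    (ht : t ∈ Icc (0 : ℝ) 1) : (t * z : ℂ) ∈ Metric.ball (0 : ℂ) r := by
  rw [mem_ball_zero_iff] at hz ⊢
  rw [norm_mul, Complex.norm_real, Real.norm_eq_abs, abs_of_nonneg ht.1]
  nlinarith [ht.1, ht.2, norm_nonneg z]

lemma continuousOn_ray {r : ℝ} {f : ℂ → ℂ} (hf : ContinuousOn f (Metric.ball 0 r)) {z : ℂ}
    (hz : z ∈ Metric.ball (0 : ℂ) r) : ContinuousOn (fun t : ℝ => f (t * z)) (Icc 0 1) :=
  hf.comp (by fun_prop) fun _ ht => ofReal_mul_mem_ball hz ht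

lemma differentiableOn_rayAvg {κ : ℝ} (hκ : 0 ≤ κ) {r : ℝ} {f : ℂ → ℂ}
    (hf : DifferentiableOn ℂ f (Metric.ball 0 r)) :
    DifferentiableOn ℂ (rayAvg κ f) (Metric.ball 0 r) := by
  intro z₀ hz₀
  apply DifferentiableAt.differentiableWithinAt
  have hz₀' := mem_ball_zero_iff.1 hz₀
  obtain ⟨r', hr₁, hr₂⟩ := exists_between hz₀'
  have hsub : Metric.closedBall (0 : ℂ) r' ⊆ Metric.ball 0 r := Metric.closedBall_subset_ball hr₂
  have hsub' : Metric.ball (0 : ℂ) r' ⊆ Metric.ball 0 r := Metric.ball_subset_ball hr₂.le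
  have hd : ContinuousOn (deriv f) (Metric.ball 0 r) :=
    (hf.deriv Metric.isOpen_ball).continuousOn
  obtain ⟨C, hC⟩ := (isCompact_closedBall (0 : ℂ) r').exists_bound_of_continuousOn (hd.mono hsub)
  have hs : Metric.ball (0 : ℂ) r' ∈ nhds z₀ :=
    Metric.isOpen_ball.mem_nhds (mem_ball_zero_iff.2 hr₁)
  refine (intervalIntegral.hasDerivAt_integral_of_dominated_loc_of_deriv_le
    (F := fun z (t : ℝ) => ((t ^ κ : ℝ) : ℂ) * f (t * z))
    (F' := fun z (t : ℝ) => ((t ^ κ : ℝ) : ℂ) * (deriv f (t * z) * t))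
    (bound := fun _ => C) hs ?_ ?_ ?_ ?_ ?_ ?_).2.differentiableAt
  · filter_upwards [hs] with z hz
    have := intervalIntegrable_rayAvg hκ (continuousOn_ray hf.continuousOn (hsub' hz))
    exact (intervalIntegrable_iff.1 this).aestronglyMeasurable
  · exact intervalIntegrable_rayAvg hκ (continuousOn_ray hf.continuousOn hz₀)
  · have h1 : ContinuousOn (fun t : ℝ => deriv f (t * z₀) * t) (Icc 0 1) :=
      (continuousOn_ray hd hz₀).mul (by fun_prop)
    have h2 : IntervalIntegrable (fun t : ℝ => ((t ^ κ : ℝ) : ℂ) * (deriv f (t * z₀) * t))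
        MeasureTheory.volume 0 1 := by
      apply ContinuousOn.intervalIntegrable
      rw [uIcc_of_le zero_le_one]
      exact (continuous_ofReal_rpow hκ).continuousOn.mul h1
    exact (intervalIntegrable_iff.1 h2).aestronglyMeasurable
  · refine Eventually.of_forall fun t ht z hz => ?_
    rw [uIoc_of_le zero_le_one] at ht
    have h1 := hC _ (Metric.ball_subset_closedBall (ofReal_mul_mem_ball hz ⟨ht.1.le, ht.2⟩))
    have h2 : |t ^ κ| ≤ 1 := by
      rw [abs_of_nonneg (Real.rpow_nonneg ht.1.le _)]
      exact Real.rpow_le_one ht.1.le ht.2 hκ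
    rw [norm_mul, norm_mul, Complex.norm_real, Complex.norm_real, Real.norm_eq_abs,
      Real.norm_eq_abs, abs_of_pos ht.1]
    calc |t ^ κ| * (‖deriv f (t * z)‖ * t) ≤ 1 * (C * 1) :=
          mul_le_mul h2 (mul_le_mul h1 ht.2 ht.1.le ((norm_nonneg _).trans h1))
            (mul_nonneg (norm_nonneg _) ht.1.le) zero_le_one
      _ = C := by ring
  · exact intervalIntegrable_const
  · refine Eventually.of_forall fun t ht z hz => ?_
    rw [uIoc_of_le zero_le_one] at ht
    have h1 : HasDerivAt f (deriv f (t * z)) (t * z) :=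
      (hf.differentiableAt (Metric.isOpen_ball.mem_nhds
        (hsub' (ofReal_mul_mem_ball hz ⟨ht.1.le, ht.2⟩)))).hasDerivAt
    have h2 : HasDerivAt (fun y : ℂ => (t : ℂ) * y) t z := by
      simpa using (hasDerivAt_id z).const_mul (t : ℂ)
    exact (h1.comp z h2).const_mul _

/-- The Picard map of the singular equation `z v' = -κ (v - v₀) + z k(z, ω, v)`, where `ω` is the
average of `v` on the segment from `0` to `z`. -/
noncomputable def singularPicard (κ : ℝ) (k : ℂ × ℂ × ℂ → ℂ) (v₀ : ℂ) (f : ℂ → ℂ) (z : ℂ) : ℂ :=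
  v₀ + z * rayAvg κ (fun y => k (y, rayAvg 0 f y, f y)) z

lemma norm_singularPicard_sub_le {κ : ℝ} (hκ : 0 ≤ κ) {k : ℂ × ℂ × ℂ → ℂ} {B : Set (ℂ × ℂ × ℂ)}
    {L : NNReal} (hk : LipschitzOnWith L k B) (v₀ : ℂ) {f g : ℂ → ℂ} {z : ℂ} {d : ℝ}
    (hf : ContinuousOn (fun t : ℝ => f (t * z)) (Icc 0 1))
    (hg : ContinuousOn (fun t : ℝ => g (t * z)) (Icc 0 1))
    (hkf : ContinuousOn (fun t : ℝ => k (t * z, rayAvg 0 f (t * z), f (t * z))) (Icc 0 1))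
    (hkg : ContinuousOn (fun t : ℝ => k (t * z, rayAvg 0 g (t * z), g (t * z))) (Icc 0 1))
    (hfB : ∀ t ∈ Icc (0 : ℝ) 1, (t * z, rayAvg 0 f (t * z), f (t * z)) ∈ B)
    (hgB : ∀ t ∈ Icc (0 : ℝ) 1, (t * z, rayAvg 0 g (t * z), g (t * z)) ∈ B)
    (hd : ∀ t ∈ Icc (0 : ℝ) 1, ‖f (t * z) - g (t * z)‖ ≤ d) :
    ‖singularPicard κ k v₀ f z - singularPicard κ k v₀ g z‖ ≤ ‖z‖ * (L * d) := by
  have h0 : ∀ t ∈ Icc (0 : ℝ) 1, ‖rayAvg 0 f (t * z) - rayAvg 0 g (t * z)‖ ≤ d := by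
    intro t ht
    have hm : ∀ s ∈ Icc (0 : ℝ) 1, s * t ∈ Icc (0 : ℝ) 1 := fun s hs =>
      ⟨mul_nonneg hs.1 ht.1, mul_le_one₀ hs.2 ht.1 ht.2⟩
    have he : ∀ s : ℝ, (s * (t * z) : ℂ) = ((s * t : ℝ) : ℂ) * z := by intro s; push_cast; ring
    refine norm_rayAvg_sub_le le_rfl ?_ ?_ ?_
    · simp only [he]
      exact hf.comp (f := fun s : ℝ => s * t) (by fun_prop) hm
    · simp only [he]
      exact hg.comp (f := fun s : ℝ => s * t) (by fun_prop) hm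
    · intro s hs
      rw [he]
      exact hd _ (hm s hs)
  have h1 : singularPicard κ k v₀ f z - singularPicard κ k v₀ g z
      = z * (rayAvg κ (fun y => k (y, rayAvg 0 f y, f y)) z
        - rayAvg κ (fun y => k (y, rayAvg 0 g y, g y)) z) := by
    unfold singularPicard; ring
  rw [h1, norm_mul]
  gcongr
  refine norm_rayAvg_sub_le hκ hkf hkg fun t ht => ?_
  have h2 := hk.norm_sub_le (hfB t ht) (hgB t ht)
  refine h2.trans ?_
  gcongr
  have hd0 : 0 ≤ d := (norm_nonneg _).trans (hd t ht)
  simp only [Prod.mk_sub_mk, sub_self, Prod.norm_mk, norm_zero]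
  exact max_le hd0 (max_le (h0 t ht) (hd t ht))

/-- Regularity at a (possibly singular) point `0` for `w' = v`,
`s v' = -κ (v - v 0) + s k(s, (w - w 0)/s, v)`. -/
lemma analyticAt_of_singular_ode {κ : ℝ} (hκ : 0 ≤ κ) {k : ℂ × ℂ × ℂ → ℂ} {w v v' : ℝ → ℝ} {r₀ : ℝ}
    (hr₀ : 0 < r₀) (hw : ∀ s, |s| < r₀ → HasDerivAt w (v s) s)
    (hv : ∀ s, |s| < r₀ → ContinuousAt v s)
    (hv' : ∀ s, s ≠ 0 → |s| < r₀ → HasDerivAt v (v' s) s)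
    (hk : AnalyticAt ℂ k (0, (v 0 : ℂ), (v 0 : ℂ)))
    (heq : ∀ s : ℝ, s ≠ 0 → |s| < r₀ → (s : ℂ) * v' s
      = -κ * (v s - v 0) + s * k (s, (((w s - w 0) / s : ℝ) : ℂ), v s)) :
    AnalyticAt ℝ w 0 := by
  set v₀ : ℂ := (v 0 : ℂ) with hv₀
  set P₀ : ℂ × ℂ × ℂ := (0, v₀, v₀) with hP₀
  -- a ball on which `k` is Lipschitz and differentiable
  obtain ⟨L, U, hU, hLU⟩ := (hk.contDiffAt (n := 1)).exists_lipschitzOnWith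
  obtain ⟨R, hR, hRU⟩ := Metric.mem_nhds_iff.1
    (inter_mem hU (hk.eventually_analyticAt))
  have hLip : LipschitzOnWith L k (Metric.ball P₀ R) := hLU.mono fun x hx => (hRU hx).1
  have hdk : DifferentiableOn ℂ k (Metric.ball P₀ R) := fun x hx =>
    (hRU hx).2.differentiableAt.differentiableWithinAt
  set M : ℝ := ‖k P₀‖ + L * R with hM
  have hM0 : 0 ≤ M := by positivity
  have hkM : ∀ x ∈ Metric.ball P₀ R, ‖k x‖ ≤ M := by
    intro x hx
    have h1 := hLip.norm_sub_le hx (Metric.mem_ball_self hR)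
    have h2 : ‖x - P₀‖ ≤ R := by
      rw [← dist_eq_norm]; exact (Metric.mem_ball.1 hx).le
    have h3 : ‖k x‖ ≤ ‖k P₀‖ + ‖k x - k P₀‖ := by
      have := norm_add_le (k P₀) (k x - k P₀)
      simpa using this
    have h4 : (L : ℝ) * ‖x - P₀‖ ≤ L * R := by gcongr
    linarith
  have hcont0 : ContinuousAt v 0 := hv 0 (by simpa using hr₀)
  obtain ⟨r₁, hr₁, hr₁v⟩ := Metric.continuousAt_iff.1 hcont0 (R / 2) (by positivity)
  -- the radius
  obtain ⟨r, hr, hrR, hrM, hrL, hr0', hr1'⟩ : ∃ r > 0, r ≤ R / 2 ∧ r * M ≤ R / 2 ∧ r * L ≤ 1 / 2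
      ∧ r ≤ r₀ ∧ r ≤ r₁ := by
    refine ⟨min (min (R / 2) (R / 2 / (M + 1))) (min (1 / 2 / (L + 1)) (min r₀ r₁)), ?_, ?_, ?_,
      ?_, ?_, ?_⟩
    · positivity
    · exact (min_le_left _ _).trans (min_le_left _ _)
    · have : min (min (R / 2) (R / 2 / (M + 1))) (min (1 / 2 / ((L : ℝ) + 1)) (min r₀ r₁))
        ≤ R / 2 / (M + 1) := (min_le_left _ _).trans (min_le_right _ _)
      calc _ ≤ R / 2 / (M + 1) * M := by gcongr
        _ ≤ R / 2 := by
          rw [div_mul_eq_mul_div, div_le_iff₀ (by positivity)]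
          nlinarith
    · have : min (min (R / 2) (R / 2 / (M + 1))) (min (1 / 2 / ((L : ℝ) + 1)) (min r₀ r₁))
        ≤ 1 / 2 / ((L : ℝ) + 1) := (min_le_right _ _).trans (min_le_left _ _)
      have hL0 : (0 : ℝ) ≤ L := L.2
      calc _ ≤ 1 / 2 / ((L : ℝ) + 1) * L := by gcongr
        _ ≤ 1 / 2 := by
          rw [div_mul_eq_mul_div, div_le_iff₀ (by positivity)]
          nlinarith
    · exact (min_le_right _ _).trans ((min_le_right _ _).trans (min_le_left _ _))
    · exact (min_le_right _ _).trans ((min_le_right _ _).trans (min_le_right _ _))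
  have hmemB : ∀ z a b : ℂ, ‖z‖ < r → ‖a - v₀‖ ≤ R / 2 → ‖b - v₀‖ ≤ R / 2 →
      (z, a, b) ∈ Metric.ball P₀ R := by
    intro z a b hz ha hb
    rw [mem_ball_iff_norm]
    simp only [hP₀, Prod.mk_sub_mk, sub_zero, Prod.norm_mk]
    exact max_lt (by linarith) (max_lt (by linarith) (by linarith))
  have havg : ∀ {f : ℂ → ℂ} {z : ℂ}, ContinuousOn (fun t : ℝ => f (t * z)) (Icc 0 1) →
      (∀ t ∈ Icc (0 : ℝ) 1, ‖f (t * z) - v₀‖ ≤ R / 2) → ‖rayAvg 0 f z - v₀‖ ≤ R / 2 := by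
    intro f z hf h
    have h1 : rayAvg 0 (fun _ => v₀) z = v₀ := by simp [rayAvg]
    have h2 := norm_rayAvg_sub_le (κ := 0) le_rfl (g := fun _ => v₀) hf continuousOn_const h
    rwa [h1] at h2
  set T : (ℂ → ℂ) → ℂ → ℂ := singularPicard κ k v₀ with hT
  set D := Metric.ball (0 : ℂ) r with hD
  -- the invariant class
  let Inv : (ℂ → ℂ) → Prop := fun f =>
    DifferentiableOn ℂ f D ∧ ∀ z ∈ D, ‖f z - v₀‖ ≤ R / 2
  have hInvB : ∀ f, Inv f → ∀ z ∈ D, (z, rayAvg 0 f z, f z) ∈ Metric.ball P₀ R := by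
    intro f hf z hz
    exact hmemB _ _ _ (mem_ball_zero_iff.1 hz) (havg (continuousOn_ray hf.1.continuousOn hz)
      fun t ht => hf.2 _ (ofReal_mul_mem_ball hz ht)) (hf.2 z hz)
  have hInvk : ∀ f, Inv f → DifferentiableOn ℂ (fun y => k (y, rayAvg 0 f y, f y)) D := by
    intro f hf
    exact hdk.comp (differentiableOn_id.prodMk ((differentiableOn_rayAvg le_rfl hf.1).prodMk hf.1))
      (hInvB f hf)
  have hInvT : ∀ f, Inv f → Inv (T f) := by
    intro f hf
    refine ⟨?_, fun z hz => ?_⟩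
    · exact (differentiableOn_const _).add
        (differentiableOn_id.mul (differentiableOn_rayAvg hκ (hInvk f hf)))
    · have h1 : ‖rayAvg κ (fun y => k (y, rayAvg 0 f y, f y)) z‖ ≤ M :=
        norm_rayAvg_le hκ fun t ht => hkM _ (hInvB f hf _ (ofReal_mul_mem_ball hz ht))
      simp only [hT, singularPicard, add_sub_cancel_left, norm_mul]
      calc _ ≤ r * M := by
            gcongr
            exact (mem_ball_zero_iff.1 hz).le
        _ ≤ R / 2 := hrM
  -- the iterates
  let F : ℕ → ℂ → ℂ := fun n => T^[n] fun _ => v₀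
  have hFs : ∀ n, F (n + 1) = T (F n) := fun n => Function.iterate_succ_apply' _ _ _
  have hFI : ∀ n, Inv (F n) := by
    intro n
    induction n with
    | zero => exact ⟨differentiableOn_const _, fun z _ => by simp [F]; positivity⟩
    | succ n ih => rw [hFs]; exact hInvT _ ih
  have hstep : ∀ {d : ℝ} {z : ℂ}, z ∈ D → 0 ≤ d → ‖z‖ * (L * d) ≤ d / 2 := by
    intro d z hz hd
    have h1 : ‖z‖ * L ≤ 1 / 2 := by
      refine le_trans ?_ hrL
      gcongr
      exact (mem_ball_zero_iff.1 hz).le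
    nlinarith
  have hFd : ∀ n, ∀ z ∈ D, ‖F (n + 1) z - F n z‖ ≤ (R / 2) * (1 / 2) ^ n := by
    intro n
    induction n with
    | zero =>
      intro z hz
      simpa [F] using (hFI 1).2 z hz
    | succ n ih =>
      intro z hz
      have h1 := norm_singularPicard_sub_le hκ hLip v₀ (f := F (n + 1)) (g := F n) (z := z)
        (d := (R / 2) * (1 / 2) ^ n)
        (continuousOn_ray (hFI _).1.continuousOn hz) (continuousOn_ray (hFI _).1.continuousOn hz)
        (continuousOn_ray (hInvk _ (hFI _)).continuousOn hz)
        (continuousOn_ray (hInvk _ (hFI _)).continuousOn hz)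
        (fun t ht => hInvB _ (hFI _) _ (ofReal_mul_mem_ball hz ht))
        (fun t ht => hInvB _ (hFI _) _ (ofReal_mul_mem_ball hz ht))
        (fun t ht => ih _ (ofReal_mul_mem_ball hz ht))
      rw [hFs (n + 1)]
      nth_rewrite 2 [hFs n]
      refine h1.trans ((hstep hz (by positivity)).trans (le_of_eq ?_))
      ring
  -- the real solution is a fixed point along the real axis
  let f : ℂ → ℂ := fun z => (v z.re : ℂ)
  have hre : ∀ t s : ℝ, ((t : ℂ) * (s : ℂ)).re = t * s := by intro t s; simp
  have habs : ∀ {t s : ℝ}, t ∈ Icc (0 : ℝ) 1 → |s| < r → |t * s| < r := by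
    intro t s ht hs
    rw [abs_mul, abs_of_nonneg ht.1]
    nlinarith [ht.1, ht.2, abs_nonneg s]
  have hfc : ∀ s : ℝ, |s| < r → ContinuousOn (fun t : ℝ => f (t * s)) (Icc 0 1) := by
    intro s hs t ht
    have : ContinuousAt v (t * s) := hv _ ((habs ht hs).trans_le hr0')
    simp only [f, hre]
    exact (Complex.continuous_ofReal.continuousAt.comp
      (ContinuousAt.comp (f := fun t : ℝ => t * s) this (by fun_prop))).continuousWithinAt
  have hfv : ∀ s : ℝ, |s| < r → ‖f s - v₀‖ ≤ R / 2 := by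
    intro s hs
    have := hr₁v (x := s) (by simpa using hs.trans_le hr1')
    simp only [f, hv₀, Complex.ofReal_re]
    rw [← Complex.ofReal_sub, Complex.norm_real, ← dist_eq_norm]
    exact this.le
  let ω : ℝ → ℝ := dslope w 0
  have hω : ∀ s : ℝ, s ≠ 0 → ω s = (w s - w 0) / s := by
    intro s hs
    simp only [ω, dslope_of_ne _ hs, slope_def_field, sub_zero]
  have hω0 : ω 0 = v 0 := by
    simp only [ω, dslope_same]
    exact (hw 0 (by simpa using hr₀)).deriv
  have hωc : ∀ s, |s| < r → ContinuousAt ω s := by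
    intro s hs
    rcases eq_or_ne s 0 with rfl | hs0
    · exact continuousAt_dslope_same.2 (hw 0 (by simpa using hr₀)).differentiableAt
    · exact (continuousAt_dslope_of_ne hs0).2 (hw s (hs.trans_le hr0')).continuousAt
  have hωr : ∀ s : ℝ, |s| < r → rayAvg 0 f s = ω s := by
    intro s hs
    have h1 : rayAvg 0 f s = ((∫ t in (0 : ℝ)..1, v (t * s) : ℝ) : ℂ) := by
      rw [← intervalIntegral.integral_ofReal]
      simp [rayAvg, f]
    rw [h1]
    congr 1
    rcases eq_or_ne s 0 with rfl | hs0
    · simp [hω0]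
    · have h2 : ∫ t in (0 : ℝ)..1, v (t * s) * s = w (1 * s) - w (0 * s) := by
        refine intervalIntegral.integral_eq_sub_of_hasDerivAt (f := fun t => w (t * s)) ?_ ?_
        · intro t ht
          rw [uIcc_of_le zero_le_one] at ht
          exact (hw _ ((habs ht hs).trans_le hr0')).comp t (hasDerivAt_mul_const s)
        · apply ContinuousOn.intervalIntegrable
          rw [uIcc_of_le zero_le_one]
          intro t ht
          have : ContinuousAt v (t * s) := hv _ ((habs ht hs).trans_le hr0')
          exact ((ContinuousAt.comp (f := fun t : ℝ => t * s) this (by fun_prop)).mul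
            continuousAt_const).continuousWithinAt
      rw [intervalIntegral.integral_mul_const] at h2
      rw [hω s hs0, eq_div_iff hs0, h2]
      simp
  have hfB : ∀ s : ℝ, |s| < r → ((s : ℂ), rayAvg 0 f s, f s) ∈ Metric.ball P₀ R := by
    intro s hs
    refine hmemB _ _ _ (by simpa using hs) (havg (hfc s hs) fun t ht => ?_) (hfv s hs)
    have := hfv (t * s) (habs ht hs)
    simpa using this
  have hfk : ∀ s : ℝ, |s| < r →
      ContinuousOn (fun t : ℝ => k (t * s, rayAvg 0 f (t * s), f (t * s))) (Icc 0 1) := by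
    intro s hs
    refine hdk.continuousOn.comp (f := fun t : ℝ => ((t * s : ℂ), rayAvg 0 f (t * s), f (t * s)))
      ?_ ?_
    · refine ContinuousOn.prodMk (by fun_prop) (ContinuousOn.prodMk ?_ (hfc s hs))
      refine ContinuousOn.congr (f := fun t : ℝ => (ω (t * s) : ℂ)) ?_ ?_
      · intro t ht
        exact (Complex.continuous_ofReal.continuousAt.comp
          (ContinuousAt.comp (f := fun t : ℝ => t * s) (hωc _ (habs ht hs))
            (by fun_prop))).continuousWithinAt
      · intro t ht
        have := hωr (t * s) (habs ht hs)
        push_cast at this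
        exact this
    · intro t ht
      have := hfB (t * s) (habs ht hs)
      push_cast at this
      exact this
  have hfT : ∀ s : ℝ, |s| < r → T f s = v s := by
    intro s hs
    rcases eq_or_ne s 0 with rfl | hs0
    · simp [hT, singularPicard, hv₀]
    have h2 : ∫ t in (0 : ℝ)..1, ((t ^ κ : ℝ) : ℂ) *
        k (t * s, rayAvg 0 f (t * s), f (t * s)) * s
        = ((1 ^ κ : ℝ) : ℂ) * ((v (1 * s) : ℂ) - v₀) - ((0 ^ κ : ℝ) : ℂ) * ((v (0 * s) : ℂ) - v₀) := by
      refine intervalIntegral.integral_eq_sub_of_hasDerivAt_of_le zero_le_one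
        (f := fun t : ℝ => ((t ^ κ : ℝ) : ℂ) * ((v (t * s) : ℂ) - v₀)) ?_ ?_ ?_
      · refine (continuous_ofReal_rpow hκ).continuousOn.mul (ContinuousOn.sub ?_ continuousOn_const)
        have := hfc s hs
        simpa only [f, hre] using this
      · intro t ht
        have ht' : t ∈ Icc (0 : ℝ) 1 := ⟨ht.1.le, ht.2.le⟩
        have hts : t * s ≠ 0 := mul_ne_zero ht.1.ne' hs0
        have hd1 : HasDerivAt (fun t : ℝ => ((t ^ κ : ℝ) : ℂ)) ((κ * t ^ (κ - 1) : ℝ) : ℂ) t :=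
          (Real.hasDerivAt_rpow_const (Or.inl ht.1.ne')).ofReal_comp
        have hd2 : HasDerivAt (fun t : ℝ => (v (t * s) : ℂ) - v₀) ((v' (t * s) * s : ℝ) : ℂ) t := by
          have h3 : HasDerivAt (fun t : ℝ => v (t * s)) (v' (t * s) * s) t :=
            (hv' _ hts ((habs ht' hs).trans_le hr0')).comp t (hasDerivAt_mul_const s)
          exact h3.ofReal_comp.sub_const _
        have h4 := heq (t * s) hts ((habs ht' hs).trans_le hr0')
        rw [← hω _ hts, ← hωr _ (habs ht' hs)] at h4
        refine (hd1.mul hd2).congr_deriv ?_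
        have h5 : ((t ^ κ : ℝ) : ℂ) = ((t ^ (κ - 1) : ℝ) : ℂ) * t := by
          rw [Real.rpow_sub_one ht.1.ne']
          push_cast
          rw [div_mul_cancel₀]
          exact_mod_cast ht.1.ne'
        rw [h5]
        push_cast at h4 ⊢
        simp only [f] at h4 ⊢
        rw [hre]
        linear_combination ((t ^ (κ - 1) : ℝ) : ℂ) * h4
      · apply ContinuousOn.intervalIntegrable
        rw [uIcc_of_le zero_le_one]
        exact ((continuous_ofReal_rpow hκ).continuousOn.mul (hfk s hs)).mul continuousOn_const
    rw [intervalIntegral.integral_mul_const] at h2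
    simp only [Real.one_rpow, one_mul, zero_mul, ← hv₀, sub_self, mul_zero, sub_zero,
      Complex.ofReal_one] at h2
    simp only [hT, singularPicard]
    unfold rayAvg at h2 ⊢
    rw [mul_comm, h2]
    ring
  have hFf : ∀ n, ∀ s : ℝ, |s| < r → ‖F n s - f s‖ ≤ (R / 2) * (1 / 2) ^ n := by
    intro n
    induction n with
    | zero =>
      intro s hs
      simpa [F, norm_sub_rev] using hfv s hs
    | succ n ih =>
      intro s hs
      have hz : (s : ℂ) ∈ D := by simpa [hD] using hs
      have hB : ∀ t ∈ Icc (0 : ℝ) 1,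
          ((t * s : ℂ), rayAvg 0 f (t * s), f (t * s)) ∈ Metric.ball P₀ R := by
        intro t ht
        have := hfB (t * s) (habs ht hs)
        push_cast at this
        exact this
      have h1 := norm_singularPicard_sub_le hκ hLip v₀ (f := F n) (g := f) (z := s)
        (d := (R / 2) * (1 / 2) ^ n)
        (continuousOn_ray (hFI _).1.continuousOn hz) (hfc s hs)
        (continuousOn_ray (hInvk _ (hFI _)).continuousOn hz) (hfk s hs)
        (fun t ht => hInvB _ (hFI _) _ (ofReal_mul_mem_ball hz ht)) hB
        (fun t ht => by
          have := ih (t * s) (habs ht hs)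
          push_cast at this
          exact this)
      rw [hFs n]
      have h2 : f s = T f s := by rw [hfT s hs]; simp [f]
      rw [h2]
      refine h1.trans ((hstep hz (by positivity)).trans (le_of_eq ?_))
      ring
  -- the holomorphic limit
  have hsum : Summable fun n : ℕ => (R / 2) * (1 / 2 : ℝ) ^ n :=
    (summable_geometric_of_lt_one (by norm_num) (by norm_num)).mul_left _
  let V : ℂ → ℂ := fun z => v₀ + ∑' n, (F (n + 1) z - F n z)
  have hVd : DifferentiableOn ℂ V D :=
    (differentiableOn_const _).add (Complex.differentiableOn_tsum_of_summable_norm hsum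
      (fun n => (hFI (n + 1)).1.sub (hFI n).1) Metric.isOpen_ball hFd)
  have hVf : ∀ s : ℝ, |s| < r → V s = f s := by
    intro s hs
    have hz : (s : ℂ) ∈ D := by simpa [hD] using hs
    have h1 : Summable fun n => F (n + 1) s - F n s :=
      Summable.of_norm_bounded hsum fun n => hFd n s hz
    have h2 := h1.hasSum.tendsto_sum_nat
    have h3 : Tendsto (fun n => F n (s : ℂ)) atTop (nhds (f s)) := by
      rw [tendsto_iff_norm_sub_tendsto_zero]
      refine squeeze_zero (fun _ => norm_nonneg _) (fun n => hFf n s hs) ?_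
      exact hsum.tendsto_atTop_zero
    have h4 : ∀ n, ∑ i ∈ Finset.range n, (F (i + 1) s - F i s) = F n s - v₀ := by
      intro n
      rw [Finset.sum_range_sub (fun i => F i (s : ℂ))]
      simp [F]
    simp only [h4] at h2
    have h5 := tendsto_nhds_unique h2 (h3.sub_const v₀)
    simp only [V, h5]
    ring
  let W : ℂ → ℂ := fun z => (w 0 : ℂ) + z * rayAvg 0 V z
  have hWd : DifferentiableOn ℂ W D :=
    (differentiableOn_const _).add (differentiableOn_id.mul (differentiableOn_rayAvg le_rfl hVd))
  have hWa : AnalyticAt ℂ W ((0 : ℝ) : ℂ) := by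
    refine hWd.analyticAt (Metric.isOpen_ball.mem_nhds ?_)
    simpa using hr
  refine hWa.re_ofReal.congr ?_
  filter_upwards [Metric.ball_mem_nhds (0 : ℝ) hr] with s hs
  have hs' : |s| < r := by simpa using hs
  have h1 : rayAvg 0 V s = rayAvg 0 f s := by
    unfold rayAvg
    refine intervalIntegral.integral_congr fun t ht => ?_
    rw [uIcc_of_le zero_le_one] at ht
    have := hVf (t * s) (habs ht hs')
    push_cast at this
    simp only [this]
  simp only [W, h1, hωr s hs']
  rcases eq_or_ne s 0 with rfl | hs0
  · simp
  · rw [hω s hs0]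
    norm_cast
    field_simp
    ring

/-- The nonlinearity `|y|^(p-1) y - c y`. -/
noncomputable def gNL (p c y : ℝ) : ℝ := |y| ^ (p - 1) * y - c * y

/-- The potential, a primitive of `gNL`. -/
noncomputable def potNL (p c y : ℝ) : ℝ := |y| ^ (p + 1) / (p + 1) - c * y ^ 2 / 2

/-- At the point `x`, `w` has derivatives `w₁`, `w₂` and satisfies
`(x² - 1) w'' + 2κ x w' + |w|^(p-1) w - c w = 0`. -/
structure SolAt (p κ c : ℝ) (w w₁ w₂ : ℝ → ℝ) (x : ℝ) : Prop where
  d₁ : HasDerivAt w (w₁ x) x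
  d₂ : HasDerivAt w₁ (w₂ x) x
  eq : (x ^ 2 - 1) * w₂ x + 2 * κ * x * w₁ x + gNL p c (w x) = 0

lemma hasDerivAt_potNL {p : ℝ} (hp : 1 < p) (c y : ℝ) :
    HasDerivAt (potNL p c) (gNL p c y) y := by
  have h1 := hasDerivAt_abs_rpow y (p := p + 1) (by linarith)
  have h2 : HasDerivAt (fun y : ℝ => c * y ^ 2 / 2) (c * y) y := by
    have := (((hasDerivAt_id y).pow 2).const_mul c).div_const 2
    refine this.congr_deriv ?_
    simp
    ring
  refine ((h1.div_const (p + 1)).sub h2).congr_deriv ?_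
  unfold gNL
  have : p + 1 - 2 = p - 1 := by ring
  rw [this]
  have hp' : p + 1 ≠ 0 := by linarith
  field_simp

lemma gNL_of_pos {p c y : ℝ} (hy : 0 < y) : gNL p c y = y ^ p - c * y := by
  unfold gNL
  rw [abs_of_pos hy, Real.rpow_sub_one hy.ne', div_mul_cancel₀ _ hy.ne']

lemma ofReal_gNL {p c y : ℝ} (hy : 0 < y) :
    ((gNL p c y : ℝ) : ℂ) = (y : ℂ) ^ (p : ℂ) - c * y := by
  rw [gNL_of_pos hy]
  push_cast
  rw [Complex.ofReal_cpow hy.le]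

lemma analyticAt_of_solAt {p κ c : ℝ} (hκ : 0 ≤ κ) {w w₁ w₂ : ℝ → ℝ} {x₀ : ℝ} (hx₀ : 0 < x₀)
    (hw : ∀ᶠ x in nhds x₀, SolAt p κ c w w₁ w₂ x) (hpos : 0 < w x₀) : AnalyticAt ℝ w x₀ := by
  have hcw : ContinuousAt w x₀ := hw.self_of_nhds.d₁.continuousAt
  obtain ⟨r, hr, hrS⟩ := Metric.eventually_nhds_iff.1
    (hw.and ((hcw.eventually (lt_mem_nhds hpos)).and (lt_mem_nhds hx₀)))
  have hS : ∀ s : ℝ, |s| < r → SolAt p κ c w w₁ w₂ (x₀ + s) ∧ 0 < w (x₀ + s) ∧ 0 < x₀ + s :=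
    fun s hs => hrS (by simpa using hs)
  have hshift : ∀ s : ℝ, HasDerivAt (fun s => x₀ + s) 1 s := fun s => by
    simpa using (hasDerivAt_id s).const_add x₀
  have hd₁ : ∀ s, |s| < r → HasDerivAt (fun s => w (x₀ + s)) (w₁ (x₀ + s)) s := fun s hs => by
    have := (hS s hs).1.d₁.comp s (hshift s)
    rw [mul_one] at this
    exact this
  have hd₂ : ∀ s, |s| < r → HasDerivAt (fun s => w₁ (x₀ + s)) (w₂ (x₀ + s)) s := fun s hs => by
    have := (hS s hs).1.d₂.comp s (hshift s)
    rw [mul_one] at this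
    exact this
  let gC : ℂ → ℂ := fun z => z ^ (p : ℂ) - c * z
  have hgd : DifferentiableOn ℂ gC Complex.slitPlane := fun z hz =>
    ((differentiableAt_id.cpow_const (c := (p : ℂ)) hz).sub
      (differentiableAt_id.const_mul _)).differentiableWithinAt
  have hmem : ((w x₀ : ℝ) : ℂ) ∈ Complex.slitPlane := by simpa using hpos
  have hga : AnalyticAt ℂ gC (w x₀) :=
    hgd.analyticAt (Complex.isOpen_slitPlane.mem_nhds hmem)
  have hwC : ∀ s : ℝ, s ≠ 0 → ((w x₀ : ℂ) + s * (((w (x₀ + s) - w x₀) / s : ℝ) : ℂ))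
      = (w (x₀ + s) : ℂ) := by
    intro s hs
    have : w x₀ + s * ((w (x₀ + s) - w x₀) / s) = w (x₀ + s) := by
      field_simp; ring
    exact_mod_cast this
  have a₁ : ∀ P : ℂ × ℂ × ℂ, AnalyticAt ℂ (fun q : ℂ × ℂ × ℂ => q.1) P := fun _ => analyticAt_fst
  have a₂ : ∀ P : ℂ × ℂ × ℂ, AnalyticAt ℂ (fun q : ℂ × ℂ × ℂ => q.2.1) P := fun _ =>
    AnalyticAt.fun_comp (f := fun q : ℂ × ℂ × ℂ => q.2) analyticAt_fst analyticAt_snd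
  have a₃ : ∀ P : ℂ × ℂ × ℂ, AnalyticAt ℂ (fun q : ℂ × ℂ × ℂ => q.2.2) P := fun _ =>
    AnalyticAt.fun_comp (f := fun q : ℂ × ℂ × ℂ => q.2) analyticAt_snd analyticAt_snd
  have key : AnalyticAt ℝ (fun s => w (x₀ + s)) 0 := by
    have harg : AnalyticAt ℂ (fun q : ℂ × ℂ × ℂ => (w x₀ : ℂ) + q.1 * q.2.1)
        (0, (w₁ x₀ : ℂ), (w₁ x₀ : ℂ)) := analyticAt_const.add ((a₁ _).mul (a₂ _))
    rcases eq_or_ne x₀ 1 with h1 | h1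
    · subst h1
      have hdsl : AnalyticAt ℂ (dslope gC (w 1 : ℂ)) (w 1) :=
        ((Complex.differentiableOn_dslope (Complex.isOpen_slitPlane.mem_nhds hmem)).2
          hgd).analyticAt (Complex.isOpen_slitPlane.mem_nhds hmem)
      refine analyticAt_of_singular_ode hκ (r₀ := min r 1)
        (k := fun q => (-κ * (q.2.2 + w₁ 1)
          - q.2.1 * dslope gC (w 1 : ℂ) ((w 1 : ℂ) + q.1 * q.2.1)) / (2 + q.1))
        (lt_min hr one_pos) (fun s hs => hd₁ s (hs.trans_le (min_le_left _ _)))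
        (fun s hs => (hd₂ s (hs.trans_le (min_le_left _ _))).continuousAt)
        (fun s _ hs => hd₂ s (hs.trans_le (min_le_left _ _))) ?_ ?_
      · simp only [add_zero]
        refine AnalyticAt.div ((analyticAt_const.mul ((a₃ _).add analyticAt_const)).sub
          ((a₂ _).mul ?_)) (analyticAt_const.add (a₁ _)) (by norm_num)
        exact AnalyticAt.fun_comp (f := fun q : ℂ × ℂ × ℂ => (w 1 : ℂ) + q.1 * q.2.1)
          (by simpa using hdsl) harg
      · intro s hs0 hs
        have hs1 := abs_lt.1 (hs.trans_le (min_le_right _ _))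
        obtain ⟨hsol, hwp, -⟩ := hS s (hs.trans_le (min_le_left _ _))
        have e0 := (hS 0 (by simpa using hr)).1.eq
        have e1 := hsol.eq
        simp only [add_zero] at e0 ⊢
        rw [hwC s hs0]
        have hsub : (((w (1 + s) - w 1) / s : ℝ) : ℂ) * s * dslope gC (w 1 : ℂ) (w (1 + s))
            = gNL p c (w (1 + s)) - gNL p c (w 1) := by
          have h := sub_smul_dslope gC (w 1 : ℂ) (w (1 + s))
          rw [ofReal_gNL hwp, ofReal_gNL hpos]
          simp only [smul_eq_mul, gC] at h
          rw [← h]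
          congr 1
          have hs0' : (s : ℂ) ≠ 0 := by exact_mod_cast hs0
          push_cast
          field_simp
        have h2s : (2 + s : ℂ) ≠ 0 := by
          have : (2 + s : ℝ) ≠ 0 := by linarith
          exact_mod_cast this
        have e0' : ((2 * κ * w₁ 1 + gNL p c (w 1) : ℝ) : ℂ) = 0 := by
          rw [← Complex.ofReal_zero]; congr 1; linarith
        have e1' : ((s * (2 + s) * w₂ (1 + s) + 2 * κ * (1 + s) * w₁ (1 + s)
            + gNL p c (w (1 + s)) : ℝ) : ℂ) = 0 := by
          rw [← Complex.ofReal_zero]; congr 1; linarith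
        push_cast at e0' e1'
        rw [← mul_left_inj' h2s]
        have h3 : ∀ a b : ℂ, (a + s * (b / (2 + s))) * (2 + s) = a * (2 + s) + s * b := by
          intro a b; field_simp
        rw [h3]
        linear_combination e1' - e0' + hsub
    · have hne : (x₀ : ℂ) ^ 2 - 1 ≠ 0 := by
        have : x₀ ^ 2 - 1 ≠ 0 := by
          intro h
          have : (x₀ - 1) * (x₀ + 1) = 0 := by linarith
          rcases mul_eq_zero.1 this with h | h
          · exact h1 (by linarith)
          · linarith
        exact_mod_cast this
      have hx1 : 0 < |x₀ - 1| := abs_pos.2 (sub_ne_zero.2 h1)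
      refine analyticAt_of_singular_ode le_rfl (r₀ := min r |x₀ - 1|)
        (k := fun q => -(2 * κ * (x₀ + q.1) * q.2.2 + gC ((w x₀ : ℂ) + q.1 * q.2.1))
          / ((x₀ + q.1) ^ 2 - 1))
        (lt_min hr hx1) (fun s hs => hd₁ s (hs.trans_le (min_le_left _ _)))
        (fun s hs => (hd₂ s (hs.trans_le (min_le_left _ _))).continuousAt)
        (fun s _ hs => hd₂ s (hs.trans_le (min_le_left _ _))) ?_ ?_
      · simp only [add_zero]
        refine AnalyticAt.div (AnalyticAt.neg
          (((analyticAt_const.mul (analyticAt_const.add (a₁ _))).mul (a₃ _)).add ?_))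
          (((analyticAt_const.add (a₁ _)).pow 2).sub analyticAt_const) (by simpa using hne)
        exact AnalyticAt.fun_comp (f := fun q : ℂ × ℂ × ℂ => (w x₀ : ℂ) + q.1 * q.2.1)
          (by simpa using hga) harg
      · intro s hs0 hs
        obtain ⟨hsol, hwp, hxp⟩ := hS s (hs.trans_le (min_le_left _ _))
        have hs1 := hs.trans_le (min_le_right _ _)
        have e1 := hsol.eq
        simp only [add_zero]
        rw [hwC s hs0]
        have hne' : (x₀ + s) ^ 2 - 1 ≠ 0 := by
          intro h
          have : (x₀ + s - 1) * (x₀ + s + 1) = 0 := by linarith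
          rcases mul_eq_zero.1 this with h | h
          · have : s = -(x₀ - 1) := by linarith
            rw [this, abs_neg] at hs1
            exact lt_irrefl _ hs1
          · linarith
        have hneC : ((x₀ : ℂ) + s) ^ 2 - 1 ≠ 0 := by exact_mod_cast hne'
        have e1' : ((((x₀ + s) ^ 2 - 1) * w₂ (x₀ + s) + 2 * κ * (x₀ + s) * w₁ (x₀ + s)
            + gNL p c (w (x₀ + s)) : ℝ) : ℂ) = 0 := by
          rw [← Complex.ofReal_zero]; congr 1
        push_cast at e1'
        rw [ofReal_gNL hwp] at e1'
        simp only [gC]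
        field_simp
        push_cast
        linear_combination s * e1'
  have := AnalyticAt.fun_comp (f := fun x => x - x₀) (x := x₀) (by simpa using key) (by fun_prop)
  simpa using this

/-- The energy `(x² - 1) w'² / 2 + G(w)`. -/
noncomputable def energyNL (p c : ℝ) (w w₁ : ℝ → ℝ) (x : ℝ) : ℝ :=
  (x ^ 2 - 1) * w₁ x ^ 2 / 2 + potNL p c (w x)

lemma SolAt.hasDerivAt_energyNL {p κ c x : ℝ} {w w₁ w₂ : ℝ → ℝ} (hp : 1 < p)
    (h : SolAt p κ c w w₁ w₂ x) :
    HasDerivAt (energyNL p c w w₁) ((1 - 2 * κ) * x * w₁ x ^ 2) x := by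
  have h1 : HasDerivAt (fun x : ℝ => x ^ 2 - 1) (2 * x) x := by
    simpa using ((hasDerivAt_id x).pow 2).sub_const 1
  have h2 := ((h1.mul (h.d₂.pow 2)).div_const 2).add
    ((hasDerivAt_potNL hp c (w x)).comp x h.d₁)
  refine HasDerivAt.congr_deriv (f := energyNL p c w w₁) h2 ?_
  simp
  linear_combination w₁ x * h.eq

lemma potNL_nonneg {p c y : ℝ} (hp : 1 < p) (hc : 0 < c)
    (hy : ((p + 1) * c / 2) ^ (1 / (p - 1)) ≤ |y|) : 0 ≤ potNL p c y := by
  have hp' : 0 < p - 1 := by linarith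
  have h0 : 0 < (p + 1) * c / 2 := by positivity
  have h1 : (p + 1) * c / 2 ≤ |y| ^ (p - 1) := by
    have := Real.rpow_le_rpow (by positivity) hy hp'.le
    rwa [← Real.rpow_mul h0.le, one_div_mul_cancel hp'.ne', Real.rpow_one] at this
  have hy0 : 0 < |y| := lt_of_lt_of_le (by positivity) hy
  have h2 : |y| ^ (p + 1) = |y| ^ (p - 1) * y ^ 2 := by
    rw [← sq_abs, ← Real.rpow_natCast, ← Real.rpow_add hy0]
    congr 1
    push_cast
    ring
  unfold potNL
  rw [h2]
  have h3 : (p + 1) * c / 2 * y ^ 2 ≤ |y| ^ (p - 1) * y ^ 2 := by gcongr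
  have h4 : c * y ^ 2 / 2 ≤ |y| ^ (p - 1) * y ^ 2 / (p + 1) := by
    rw [le_div_iff₀ (by linarith)]
    linarith
  linarith

lemma exists_neg_le_potNL {p c : ℝ} (hp : 1 < p) (hc : 0 < c) :
    ∃ m > 0, ∀ y, -m ≤ potNL p c y := by
  set W := ((p + 1) * c / 2) ^ (1 / (p - 1)) with hW
  have hW0 : 0 < W := by positivity
  refine ⟨c * W ^ 2 / 2, by positivity, fun y => ?_⟩
  rcases le_total W |y| with h | h
  · have := potNL_nonneg hp hc h
    have : 0 < c * W ^ 2 / 2 := by positivity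
    linarith
  · have h1 : y ^ 2 ≤ W ^ 2 := by
      rw [← sq_abs]; gcongr
    have h2 : 0 ≤ |y| ^ (p + 1) / (p + 1) := by positivity
    unfold potNL
    have : c * y ^ 2 ≤ c * W ^ 2 := by gcongr
    linarith

/-- The inversion `x ↦ x^(-α) f (1/x)`. -/
noncomputable def kelvin (α : ℝ) (f : ℝ → ℝ) (x : ℝ) : ℝ := x ^ (-α) * f x⁻¹

/-- The first derivative of `kelvin α f`, where `f₁` is the derivative of `f`. -/
noncomputable def kelvin₁ (α : ℝ) (f f₁ : ℝ → ℝ) (x : ℝ) : ℝ :=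
  -α * kelvin (α + 1) f x - kelvin (α + 2) f₁ x

/-- The second derivative of `kelvin α f`, where `f₁`, `f₂` are the derivatives of `f`. -/
noncomputable def kelvin₂ (α : ℝ) (f f₁ f₂ : ℝ → ℝ) (x : ℝ) : ℝ :=
  -α * kelvin₁ (α + 1) f f₁ x - kelvin₁ (α + 2) f₁ f₂ x

lemma hasDerivAt_kelvin (α : ℝ) {f f₁ : ℝ → ℝ} {x : ℝ} (hx : 0 < x)
    (h : HasDerivAt f (f₁ x⁻¹) x⁻¹) : HasDerivAt (kelvin α f) (kelvin₁ α f f₁ x) x := by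
  have h1 := (Real.hasDerivAt_rpow_const (p := -α) (Or.inl hx.ne')).mul
    (h.comp x (hasDerivAt_inv hx.ne'))
  refine HasDerivAt.congr_deriv (f := kelvin α f) h1 ?_
  unfold kelvin₁ kelvin
  have e1 : x ^ (-(α + 1)) = x ^ (-α - 1) := by ring_nf
  have e2 : x ^ (-(α + 2)) = x ^ (-α) * (x ^ 2)⁻¹ := by
    rw [← Real.rpow_natCast, ← Real.rpow_neg hx.le, ← Real.rpow_add hx]
    congr 1
    push_cast
    ring
  rw [e1, e2]
  simp
  ring

lemma hasDerivAt_kelvin₁ (α : ℝ) {f f₁ f₂ : ℝ → ℝ} {x : ℝ} (hx : 0 < x)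
    (h : HasDerivAt f (f₁ x⁻¹) x⁻¹) (h' : HasDerivAt f₁ (f₂ x⁻¹) x⁻¹) :
    HasDerivAt (kelvin₁ α f f₁) (kelvin₂ α f f₁ f₂ x) x :=
  ((hasDerivAt_kelvin (α + 1) hx h).const_mul (-α)).sub (hasDerivAt_kelvin (α + 2) hx h')

lemma kelvin_add (α k : ℝ) (f : ℝ → ℝ) {x : ℝ} (hx : 0 < x) :
    kelvin (α + k) f x = x ^ (-α) * x ^ (-k) * f x⁻¹ := by
  unfold kelvin
  rw [neg_add, Real.rpow_add hx]

lemma kelvin₁_eq (α : ℝ) (f f₁ : ℝ → ℝ) {x : ℝ} (hx : 0 < x) :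
    kelvin₁ α f f₁ x = x ^ (-α) * (-α * x⁻¹ * f x⁻¹ - x⁻¹ ^ 2 * f₁ x⁻¹) := by
  have e2 : x ^ (-(2 : ℝ)) = x⁻¹ ^ 2 := by
    rw [Real.rpow_neg hx.le, inv_pow]; norm_cast
  unfold kelvin₁
  rw [kelvin_add _ _ _ hx, kelvin_add _ _ _ hx, Real.rpow_neg_one, e2]
  ring

lemma kelvin₂_eq (α : ℝ) (f f₁ f₂ : ℝ → ℝ) {x : ℝ} (hx : 0 < x) :
    kelvin₂ α f f₁ f₂ x = x ^ (-α) * (α * (α + 1) * x⁻¹ ^ 2 * f x⁻¹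
      + (2 * α + 2) * x⁻¹ ^ 3 * f₁ x⁻¹ + x⁻¹ ^ 4 * f₂ x⁻¹) := by
  have e2 : x ^ (-(2 : ℝ)) = x⁻¹ ^ 2 := by
    rw [Real.rpow_neg hx.le, inv_pow]; norm_cast
  unfold kelvin₂
  rw [kelvin₁_eq _ _ _ hx, kelvin₁_eq _ _ _ hx, neg_add, neg_add, Real.rpow_add hx,
    Real.rpow_add hx, Real.rpow_neg_one, e2]
  ring

lemma abs_kelvin_rpow_mul {p α : ℝ} (hα : α * (p - 1) = 2) (f : ℝ → ℝ) {x : ℝ} (hx : 0 < x) :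
    |kelvin α f x| ^ (p - 1) * kelvin α f x
      = x ^ (-α) * (x⁻¹ ^ 2 * (|f x⁻¹| ^ (p - 1) * f x⁻¹)) := by
  unfold kelvin
  have e2 : (x ^ (-α)) ^ (p - 1) = x⁻¹ ^ 2 := by
    rw [← Real.rpow_mul hx.le, neg_mul, hα, Real.rpow_neg hx.le, inv_pow]; norm_cast
  rw [abs_mul, Real.mul_rpow (abs_nonneg _) (abs_nonneg _), abs_of_pos (Real.rpow_pos_of_pos hx _),
    e2]
  ring

/-- The profile equation with `N - 1 = 2α + 2 - 2κ`, at `ρ`, with explicit derivatives. -/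
structure ProfAt (p κ α : ℝ) (u u₁ u₂ : ℝ → ℝ) (ρ : ℝ) : Prop where
  d₁ : HasDerivAt u (u₁ ρ) ρ
  d₂ : HasDerivAt u₁ (u₂ ρ) ρ
  eq : (1 - ρ ^ 2) * u₂ ρ + ((2 * α + 2 - 2 * κ) / ρ - 2 * (α + 1) * ρ) * u₁ ρ
    - α * (α + 1) * u ρ + |u ρ| ^ (p - 1) * u ρ = 0

lemma ProfAt.kelvin {p κ α : ℝ} (hα : α * (p - 1) = 2) {u u₁ u₂ : ℝ → ℝ} {x : ℝ} (hx : 0 < x)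
    (h : ProfAt p κ α u u₁ u₂ x⁻¹) :
    SolAt p κ (α * (α + 1 - 2 * κ)) (kelvin α u) (kelvin₁ α u u₁) (kelvin₂ α u u₁ u₂) x := by
  refine ⟨hasDerivAt_kelvin α hx h.d₁, hasDerivAt_kelvin₁ α hx h.d₁ h.d₂, ?_⟩
  have e := h.eq
  unfold gNL
  rw [abs_kelvin_rpow_mul hα u hx, kelvin₁_eq _ _ _ hx, kelvin₂_eq _ _ _ _ hx]
  unfold _root_.kelvin
  have hx' : x = (x⁻¹)⁻¹ := (inv_inv x).symm
  set y := x⁻¹ with hy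
  have hy0 : y ≠ 0 := (inv_pos.2 hx).ne'
  set r := x ^ (-α)
  set P := |u y| ^ (p - 1) * u y
  rw [hx']
  have e' : (1 - y ^ 2) * u₂ y * y + ((2 * α + 2 - 2 * κ) - 2 * (α + 1) * y ^ 2) * u₁ y
    - α * (α + 1) * u y * y + P * y = 0 := by
    have : ((1 - y ^ 2) * u₂ y + ((2 * α + 2 - 2 * κ) / y - 2 * (α + 1) * y) * u₁ y
      - α * (α + 1) * u y + P) * y = 0 := by rw [e, zero_mul]
    rw [← this]
    field_simp
  field_simp
  linear_combination r * y * e'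

lemma SolAt.kelvin {p κ α : ℝ} (hα : α * (p - 1) = 2) {w w₁ w₂ : ℝ → ℝ} {ρ : ℝ} (hρ : 0 < ρ)
    (h : SolAt p κ (α * (α + 1 - 2 * κ)) w w₁ w₂ ρ⁻¹) :
    ProfAt p κ α (kelvin α w) (kelvin₁ α w w₁) (kelvin₂ α w w₁ w₂) ρ := by
  refine ⟨hasDerivAt_kelvin α hρ h.d₁, hasDerivAt_kelvin₁ α hρ h.d₁ h.d₂, ?_⟩
  have e := h.eq
  unfold gNL at e
  rw [abs_kelvin_rpow_mul hα w hρ, kelvin₁_eq _ _ _ hρ, kelvin₂_eq _ _ _ _ hρ]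
  unfold _root_.kelvin
  have hx' : ρ = (ρ⁻¹)⁻¹ := (inv_inv ρ).symm
  set y := ρ⁻¹ with hy
  have hy0 : y ≠ 0 := (inv_pos.2 hρ).ne'
  set r := ρ ^ (-α)
  set P := |w y| ^ (p - 1) * w y
  rw [hx']
  field_simp
  linear_combination r * y ^ 2 * e

lemma exists_profAt {p κ α σ : ℝ} (hσ : 0 < σ) (hκ : 0 < 2 * α + 2 - 2 * κ) {u : ℝ → ℝ}
    (hu : ContDiffOn ℝ 2 u (Ico 0 σ))
    (heq : ∀ ρ ∈ Ioo 0 σ, (1 - ρ ^ 2) * deriv (deriv u) ρ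
      + ((2 * α + 2 - 2 * κ) / ρ - 2 * (α + 1) * ρ) * deriv u ρ
      - α * (α + 1) * u ρ + |u ρ| ^ (p - 1) * u ρ = 0) (hp : 1 < p) :
    ∃ u₁ u₂ : ℝ → ℝ, ContinuousOn u₁ (Ico 0 σ) ∧ u₁ 0 = 0 ∧
      ∀ ρ ∈ Ioo 0 σ, ProfAt p κ α u u₁ u₂ ρ := by
  have hU := uniqueDiffOn_Ico (0 : ℝ) σ
  set u₁ := derivWithin u (Ico 0 σ) with hu₁
  set u₂ := derivWithin u₁ (Ico 0 σ) with hu₂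
  have h1 : ContDiffOn ℝ 1 u₁ (Ico 0 σ) := hu.derivWithin hU (by norm_num)
  have h2 : ContinuousOn u₂ (Ico 0 σ) := h1.continuousOn_derivWithin hU le_rfl
  have hn : ∀ ρ ∈ Ioo 0 σ, Ico 0 σ ∈ nhds ρ := fun ρ hρ => Ico_mem_nhds hρ.1 hρ.2
  have hd1 : ∀ ρ ∈ Ioo 0 σ, HasDerivAt u (u₁ ρ) ρ := fun ρ hρ =>
    ((hu.differentiableOn (by norm_num) ρ ⟨hρ.1.le, hρ.2⟩).hasDerivWithinAt).hasDerivAt (hn ρ hρ)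
  have hd2 : ∀ ρ ∈ Ioo 0 σ, HasDerivAt u₁ (u₂ ρ) ρ := fun ρ hρ =>
    ((h1.differentiableOn (by norm_num) ρ ⟨hρ.1.le, hρ.2⟩).hasDerivWithinAt).hasDerivAt (hn ρ hρ)
  have he : ∀ ρ ∈ Ioo 0 σ, deriv u ρ = u₁ ρ ∧ deriv (deriv u) ρ = u₂ ρ := by
    intro ρ hρ
    refine ⟨(hd1 ρ hρ).deriv, ?_⟩
    have : deriv u =ᶠ[nhds ρ] u₁ := by
      filter_upwards [isOpen_Ioo.mem_nhds hρ] with x hx using (hd1 x hx).deriv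
    rw [this.deriv_eq, (hd2 ρ hρ).deriv]
  have heq' : ∀ ρ ∈ Ioo 0 σ, (1 - ρ ^ 2) * u₂ ρ
      + ((2 * α + 2 - 2 * κ) / ρ - 2 * (α + 1) * ρ) * u₁ ρ
      - α * (α + 1) * u ρ + |u ρ| ^ (p - 1) * u ρ = 0 := by
    intro ρ hρ
    have := heq ρ hρ
    rwa [(he ρ hρ).1, (he ρ hρ).2] at this
  refine ⟨u₁, u₂, h1.continuousOn, ?_, fun ρ hρ => ⟨hd1 ρ hρ, hd2 ρ hρ, heq' ρ hρ⟩⟩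
  have h0 : (0 : ℝ) ∈ Ico 0 σ := ⟨le_rfl, hσ⟩
  have hF : ContinuousOn (fun ρ => ρ * ((1 - ρ ^ 2) * u₂ ρ - 2 * (α + 1) * ρ * u₁ ρ
      - α * (α + 1) * u ρ + |u ρ| ^ (p - 1) * u ρ) + (2 * α + 2 - 2 * κ) * u₁ ρ) (Ico 0 σ) := by
    have := h1.continuousOn
    have h3 := hu.continuousOn
    have h4 : ContinuousOn (fun ρ => |u ρ| ^ (p - 1)) (Ico 0 σ) :=
      h3.abs.rpow_const fun _ _ => Or.inr (by linarith)
    fun_prop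
  have hF0 : ∀ ρ ∈ Ioo 0 σ, ρ * ((1 - ρ ^ 2) * u₂ ρ - 2 * (α + 1) * ρ * u₁ ρ
      - α * (α + 1) * u ρ + |u ρ| ^ (p - 1) * u ρ) + (2 * α + 2 - 2 * κ) * u₁ ρ = 0 := by
    intro ρ hρ
    have := heq' ρ hρ
    have hρ0 := hρ.1.ne'
    calc _ = ρ * ((1 - ρ ^ 2) * u₂ ρ
      + ((2 * α + 2 - 2 * κ) / ρ - 2 * (α + 1) * ρ) * u₁ ρ
      - α * (α + 1) * u ρ + |u ρ| ^ (p - 1) * u ρ) := by field_simp; ring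
      _ = 0 := by rw [this, mul_zero]
  have ht := (hF 0 h0).mono Ioo_subset_Ico_self
  have hne : (nhdsWithin (0 : ℝ) (Ioo 0 σ)).NeBot := by
    rw [nhdsWithin_Ioo_eq_nhdsGT hσ]; infer_instance
  have := tendsto_nhds_unique ht.tendsto
    ((tendsto_const_nhds (x := (0 : ℝ))).congr' (by
      filter_upwards [self_mem_nhdsWithin] with ρ hρ using (hF0 ρ hρ).symm))
  simp at this
  rcases this with h | h
  · linarith
  · exact h

/-- Large solutions of the profile equation stay large and nearly flat on an interval
`(0, c B^(-(p-1)/2)]`. -/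
lemma exists_profile_bound {p κ α : ℝ} (hp : 1 < p) (hα : 0 < α) (hκ : κ < 1 / 2) :
    ∃ c > 0, c ≤ 1 / 4 ∧ ∃ B₀ ≥ 1, ∀ σ > 1, ∀ u u₁ u₂ : ℝ → ℝ, ContinuousOn u (Ico 0 σ) →
      ContinuousOn u₁ (Ico 0 σ) → u₁ 0 = 0 → (∀ ρ ∈ Ioo 0 σ, ProfAt p κ α u u₁ u₂ ρ) →
      B₀ ≤ u 0 → ∀ ρ, 0 < ρ → ρ ≤ c / u 0 ^ ((p - 1) / 2) →
        u 0 / 2 ≤ u ρ ∧ α * u 0 / 4 ≤ α * u ρ + ρ * u₁ ρ := by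
  have ha : 0 < α * (α + 1) := by positivity
  obtain ⟨m, hm, hpot⟩ := exists_neg_le_potNL hp ha
  refine ⟨min (1 / 4) (α / 8), by positivity, min_le_left _ _,
    max 1 (2 * m / (α * (α + 1))), le_max_left _ _, ?_⟩
  intro σ hσ u u₁ u₂ hu hu₁ hu₁0 hsol hB ρ hρ0 hρ
  set c := min (1 / 4) (α / 8) with hc
  have hc0 : 0 < c := by positivity
  have hc1 : c ≤ 1 / 4 := min_le_left _ _
  have hc2 : c ≤ α / 8 := min_le_right _ _
  set B := u 0 with hBdef
  have hB1 : 1 ≤ B := (le_max_left _ _).trans hB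
  have hB2 : m ≤ α * (α + 1) * B ^ 2 / 2 := by
    have h := (le_max_right _ _).trans hB
    rw [div_le_iff₀ ha] at h
    nlinarith
  set β := B ^ ((p - 1) / 2) with hβ
  have hβ1 : 1 ≤ β := Real.one_le_rpow hB1 (by linarith)
  have hBβ : B ^ (p + 1) = (B * β) ^ 2 := by
    rw [mul_pow, hβ, ← Real.rpow_natCast, ← Real.rpow_natCast, ← Real.rpow_mul (by linarith),
      ← Real.rpow_add (by linarith)]
    congr 1; push_cast; ring
  have hρ4 : ρ ≤ 1 / 4 := hρ.trans ((div_le_self hc0.le hβ1).trans hc1)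
  have hsub : Icc 0 ρ ⊆ Ico 0 σ := fun x hx => ⟨hx.1, by linarith [hx.2]⟩
  have hsub' : ∀ x ∈ Ioo 0 ρ, x ∈ Ioo 0 σ := fun x hx => ⟨hx.1, by linarith [hx.2]⟩
  let e : ℝ → ℝ := fun x => (1 - x ^ 2) * u₁ x ^ 2 / 2 + potNL p (α * (α + 1)) (u x)
  have hpc : Continuous (potNL p (α * (α + 1))) :=
    continuous_iff_continuousAt.2 fun y => (hasDerivAt_potNL hp _ y).continuousAt
  have hec : ContinuousOn e (Icc 0 ρ) := by
    have h1 := hu.mono hsub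
    have h2 := hu₁.mono hsub
    have h3 := hpc.comp_continuousOn h1
    exact ContinuousOn.add (by fun_prop) h3
  have hanti : AntitoneOn e (Icc 0 ρ) := by
    refine antitoneOn_of_hasDerivWithinAt_nonpos (convex_Icc 0 ρ) hec
      (f' := fun x => -(x + ((2 * α + 2 - 2 * κ) / x - 2 * (α + 1) * x)) * u₁ x ^ 2) ?_ ?_
    · intro x hx
      rw [interior_Icc] at hx
      have hs := hsol x (hsub' x hx)
      have h1 : HasDerivAt (fun x : ℝ => 1 - x ^ 2) (-(2 * x)) x := by
        simpa using ((hasDerivAt_id x).pow 2).const_sub 1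
      have h2 := ((h1.mul (hs.d₂.pow 2)).div_const 2).add
        ((hasDerivAt_potNL hp (α * (α + 1)) (u x)).comp x hs.d₁)
      refine (HasDerivAt.congr_deriv (f := e) h2 ?_).hasDerivWithinAt
      simp [gNL]
      linear_combination u₁ x * hs.eq
    · intro x hx
      rw [interior_Icc] at hx
      have hx0 := hx.1
      have h1 : 2 * (α + 1) * x ≤ (2 * α + 2 - 2 * κ) / x := by
        rw [le_div_iff₀ hx0]
        have : x * x ≤ 1 / 16 := by nlinarith [hx.2]
        nlinarith
      have : 0 ≤ (x + ((2 * α + 2 - 2 * κ) / x - 2 * (α + 1) * x)) * u₁ x ^ 2 := by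
        have : 0 ≤ x + ((2 * α + 2 - 2 * κ) / x - 2 * (α + 1) * x) := by linarith
        positivity
      linarith
  have hbound : ∀ x ∈ Icc 0 ρ, |u₁ x| ≤ 2 * (B * β) := by
    intro x hx
    have h1 := hanti (left_mem_Icc.2 hρ0.le) hx hx.1
    have h2 : (1 - x ^ 2) * u₁ x ^ 2 / 2 + potNL p (α * (α + 1)) (u x)
        ≤ potNL p (α * (α + 1)) B := by
      simpa [e, hu₁0] using h1
    have h3 : potNL p (α * (α + 1)) B ≤ (B * β) ^ 2 / 2 - m := by
      unfold potNL
      rw [abs_of_pos (by linarith), hBβ]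
      have : (B * β) ^ 2 / (p + 1) ≤ (B * β) ^ 2 / 2 := by gcongr; linarith
      linarith
    have h4 := hpot (u x)
    have h5 : x ^ 2 ≤ 1 / 16 := by nlinarith [hx.1, hx.2]
    refine abs_le_of_sq_le_sq ?_ (by positivity)
    nlinarith [sq_nonneg (u₁ x)]
  have hρβ : ρ * β ≤ c := by rwa [le_div_iff₀ (by linarith)] at hρ
  have hBρ : 2 * (B * β) * ρ ≤ 2 * c * B := by nlinarith
  have hlip : |u ρ - u 0| ≤ 2 * (B * β) * ρ := by
    obtain ⟨x, hx, hxe⟩ := exists_hasDerivAt_eq_slope u u₁ hρ0 (hu.mono hsub)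
      fun x hx => (hsol x (hsub' x hx)).d₁
    have h := hbound x ⟨hx.1.le, hx.2.le⟩
    rw [sub_zero, eq_div_iff hρ0.ne'] at hxe
    rw [← hxe, abs_mul, abs_of_pos hρ0]
    gcongr
  have h1 := abs_le.1 hlip
  have h2 := abs_le.1 (hbound ρ (right_mem_Icc.2 hρ0.le))
  constructor
  · nlinarith
  · have h3 : -(2 * (B * β)) * ρ ≤ ρ * u₁ ρ := by nlinarith
    have h4 : B / 2 ≤ u ρ := by nlinarith
    nlinarith

/-- For large initial data, the inverted solution is positive with very negative energy at
some far away point. -/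
lemma exists_energy_le {p κ α : ℝ} (hp : 1 < p) (hα : 0 < α) (hαp : α * (p - 1) = 2)
    (hκ : κ < 1 / 2) :
    ∃ δ > 0, ∀ X, ∃ B₀ > 0, ∀ σ > 1, ∀ u u₁ u₂ : ℝ → ℝ, ContinuousOn u (Ico 0 σ) →
      ContinuousOn u₁ (Ico 0 σ) → u₁ 0 = 0 → (∀ ρ ∈ Ioo 0 σ, ProfAt p κ α u u₁ u₂ ρ) →
      B₀ ≤ u 0 → ∃ x₁ ≥ X, (∀ x ≥ x₁, 0 < kelvin α u x) ∧
        energyNL p (α * (α + 1 - 2 * κ)) (kelvin α u) (kelvin₁ α u u₁) x₁ ≤ -δ := by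
  obtain ⟨c, hc0, hc4, B₀, hB₀, H⟩ := exists_profile_bound (κ := κ) hp hα hκ
  set K := (1 - 2 * κ) * α / 32 with hK
  have hK0 : 0 < K := by
    have : 0 < 1 - 2 * κ := by linarith
    positivity
  refine ⟨K * c ^ (2 * α), by positivity, fun X => ?_⟩
  have hq : 0 < (p - 1) / 2 := by linarith
  obtain ⟨B₁, hB₁⟩ := ((tendsto_rpow_atTop hq).eventually_ge_atTop (c * X)).exists_forall_of_atTop
  refine ⟨max B₀ B₁, by positivity, fun σ hσ u u₁ u₂ hu hu₁ hu₁0 hsol hB => ?_⟩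
  set B := u 0 with hBdef
  have hBB₀ : B₀ ≤ B := (le_max_left _ _).trans hB
  have hB1 : 1 ≤ B := hB₀.trans hBB₀
  set β := B ^ ((p - 1) / 2) with hβ
  have hβ0 : 1 ≤ β := Real.one_le_rpow hB1 hq.le
  have hβ1 : 0 < β := by linarith
  set x₁ := β / c with hx₁
  have hx₁0 : 1 < x₁ := by
    rw [hx₁, lt_div_iff₀ hc0]; linarith
  have hx₁X : X ≤ x₁ := by
    rw [hx₁, le_div_iff₀ hc0, mul_comm]
    exact hB₁ B ((le_max_right _ _).trans hB)
  have hP := H σ hσ u u₁ u₂ hu hu₁ hu₁0 hsol hBB₀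
  have hP' : ∀ x ≥ x₁, u 0 / 2 ≤ u x⁻¹ ∧ α * u 0 / 4 ≤ α * u x⁻¹ + x⁻¹ * u₁ x⁻¹ := by
    intro x hx
    have hx0 : 0 < x := by linarith
    refine hP x⁻¹ (inv_pos.2 hx0) ?_
    rw [← inv_div]
    exact inv_anti₀ (by positivity) hx
  refine ⟨x₁, hx₁X, fun x hx => ?_, ?_⟩
  · have hx0 : 0 < x := by linarith
    exact mul_pos (Real.rpow_pos_of_pos hx0 _) (by linarith [(hP' x hx).1])
  set C := α * (α + 1 - 2 * κ) with hC
  have hS : ∀ x ≥ x₁, SolAt p κ C (kelvin α u) (kelvin₁ α u u₁) (kelvin₂ α u u₁ u₂) x := by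
    intro x hx
    have hx0 : 1 < x := by linarith
    refine ProfAt.kelvin hαp (by linarith) (hsol _ ⟨by positivity, ?_⟩)
    exact (inv_lt_one_of_one_lt₀ hx0).trans hσ
  have hk1 : ∀ x > 0, kelvin₁ α u u₁ x = -(x ^ (-α) * x⁻¹ * (α * u x⁻¹ + x⁻¹ * u₁ x⁻¹)) := by
    intro x hx
    rw [kelvin₁_eq _ _ _ hx]
    ring
  let Ψ : ℝ → ℝ := fun x => energyNL p C (kelvin α u) (kelvin₁ α u u₁) x
    + K * B ^ 2 * x ^ (-(2 * α))
  have hΨd : ∀ x ≥ x₁, HasDerivAt Ψ ((1 - 2 * κ) * x * kelvin₁ α u u₁ x ^ 2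
      + K * B ^ 2 * (-(2 * α) * x ^ (-(2 * α) - 1))) x := by
    intro x hx
    exact ((hS x hx).hasDerivAt_energyNL hp).add
      ((Real.hasDerivAt_rpow_const (Or.inl (by linarith))).const_mul _)
  have hmono : MonotoneOn Ψ (Ici x₁) := by
    refine monotoneOn_of_hasDerivWithinAt_nonneg (convex_Ici x₁)
      (fun x hx => (hΨd x hx).continuousAt.continuousWithinAt)
      (fun x hx => (hΨd x (interior_subset hx)).hasDerivWithinAt) ?_
    intro x hx
    have hx := interior_subset hx
    have hx0 : 0 < x := by linarith [mem_Ici.1 hx]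
    have e1 : x ^ (-(2 * α) - 1) = (x ^ (-α)) ^ 2 * x⁻¹ := by
      rw [Real.rpow_sub_one hx0.ne', ← Real.rpow_natCast, ← Real.rpow_mul hx0.le,
        div_eq_mul_inv]
      congr 2
      push_cast; ring
    rw [hk1 x hx0, e1]
    set r := x ^ (-α)
    set s := α * u x⁻¹ + x⁻¹ * u₁ x⁻¹ with hs
    have h1 : (α * B / 4) ^ 2 ≤ s ^ 2 := by
      have := (hP' x hx).2
      gcongr
    have h2 : 0 ≤ (1 - 2 * κ) * r ^ 2 * x⁻¹ := by
      have : 0 < 1 - 2 * κ := by linarith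
      positivity
    have h3 : (1 - 2 * κ) * x * (-(r * x⁻¹ * s)) ^ 2 + K * B ^ 2 * (-(2 * α) * (r ^ 2 * x⁻¹))
        = ((1 - 2 * κ) * r ^ 2 * x⁻¹) * (s ^ 2 - (α * B / 4) ^ 2) := by
      rw [hK]
      field_simp
      ring
    rw [h3]
    exact mul_nonneg h2 (by linarith)
  have hinv : Tendsto (fun x : ℝ => x⁻¹) atTop (nhdsWithin 0 (Ico 0 σ)) := by
    refine tendsto_nhdsWithin_iff.2 ⟨tendsto_inv_atTop_zero, ?_⟩
    filter_upwards [eventually_gt_atTop 1] with x hx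
    exact ⟨by positivity, (inv_lt_one_of_one_lt₀ hx).trans hσ⟩
  have h0σ : (0 : ℝ) ∈ Ico 0 σ := ⟨le_rfl, by linarith⟩
  have hut : Tendsto (fun x : ℝ => u x⁻¹) atTop (nhds (u 0)) := (hu 0 h0σ).tendsto.comp hinv
  have hu₁t : Tendsto (fun x : ℝ => u₁ x⁻¹) atTop (nhds (u₁ 0)) := (hu₁ 0 h0σ).tendsto.comp hinv
  have hr : Tendsto (fun x : ℝ => x ^ (-α)) atTop (nhds 0) := tendsto_rpow_neg_atTop hα
  have hwt : Tendsto (kelvin α u) atTop (nhds 0) := by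
    have h := hr.mul hut
    rw [zero_mul] at h
    exact h
  have hkt : Tendsto (fun x => x * kelvin₁ α u u₁ x) atTop (nhds 0) := by
    have h := (hr.mul ((hut.const_mul α).add (tendsto_inv_atTop_zero.mul hu₁t))).neg
    rw [zero_mul, neg_zero] at h
    refine h.congr' ?_
    filter_upwards [eventually_gt_atTop 0] with x hx
    rw [hk1 x hx]
    field_simp
  have hΨt : Tendsto Ψ atTop (nhds 0) := by
    have hpc : Continuous (potNL p C) :=
      continuous_iff_continuousAt.2 fun y => (hasDerivAt_potNL hp _ y).continuousAt
    have h1 := (hpc.tendsto 0).comp hwt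
    have h2 : Tendsto (fun x : ℝ => x ^ (-(2 * α))) atTop (nhds 0) :=
      tendsto_rpow_neg_atTop (by positivity)
    have h3 := ((((hkt.pow 2).mul ((tendsto_inv_atTop_zero (𝕜 := ℝ)).pow 2).neg).add
      (hkt.pow 2)).div_const 2).add h1 |>.add (h2.const_mul (K * B ^ 2))
    have h4 : potNL p C 0 = 0 := by
      unfold potNL
      rw [abs_zero, Real.zero_rpow (by linarith)]
      simp
    simp only [h4] at h3
    norm_num at h3
    refine h3.congr' ?_
    filter_upwards [eventually_gt_atTop 0] with x hx
    simp only [Ψ, energyNL]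
    field_simp
    ring
  have hle : Ψ x₁ ≤ 0 := ge_of_tendsto hΨt (by
    filter_upwards [eventually_ge_atTop x₁] with x hx using hmono self_mem_Ici hx hx)
  have hval : B ^ 2 * x₁ ^ (-(2 * α)) = c ^ (2 * α) := by
    rw [hx₁, Real.div_rpow hβ1.le hc0.le, hβ, ← Real.rpow_mul (by linarith)]
    have : (p - 1) / 2 * -(2 * α) = -2 := by linear_combination -hαp
    rw [this, Real.rpow_neg hc0.le, Real.rpow_neg (by linarith)]
    have hB0 : B ≠ 0 := by linarith
    norm_cast
    field_simp
  have : Ψ x₁ = energyNL p C (kelvin α u) (kelvin₁ α u u₁) x₁ + K * c ^ (2 * α) := by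
    simp only [Ψ]
    rw [mul_assoc, hval]
  linarith

lemma IsCompact.exists_abs_sub_lt_of_lt {K : Set ℝ} (hK : IsCompact K) {f : ℝ → ℝ}
    (hf : ContinuousOn f K) {b : ℝ} (hb : ∀ y ∈ K, f y ≤ 0 → y = b) {η : ℝ} (hη : 0 < η) :
    ∃ ε > 0, ∀ y ∈ K, f y < ε → |y - b| < η := by
  have hcl : IsClosed {y : ℝ | η ≤ |y - b|} :=
    isClosed_le continuous_const (by fun_prop)
  rcases (K ∩ {y : ℝ | η ≤ |y - b|}).eq_empty_or_nonempty with he | hne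
  · refine ⟨1, one_pos, fun y hy _ => ?_⟩
    by_contra h
    have : y ∈ K ∩ {y : ℝ | η ≤ |y - b|} := ⟨hy, not_lt.1 h⟩
    rw [he] at this
    exact this
  · obtain ⟨y₀, hy₀, hmin⟩ := (hK.inter_right hcl).exists_isMinOn hne
      (hf.mono inter_subset_left)
    refine ⟨f y₀, ?_, fun y hy hlt => ?_⟩
    · by_contra h
      have h1 := hb y₀ hy₀.1 (not_lt.1 h)
      have h2 : η ≤ |y₀ - b| := hy₀.2
      rw [h1, sub_self, abs_zero] at h2
      linarith
    · by_contra h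
      exact absurd (hmin ⟨hy, not_lt.1 h⟩) (not_le.2 hlt)

lemma continuous_potNL {p : ℝ} (hp : 1 < p) (c : ℝ) : Continuous (potNL p c) :=
  continuous_iff_continuousAt.2 fun y => (hasDerivAt_potNL hp c y).continuousAt

lemma continuous_gNL {p : ℝ} (hp : 1 < p) (c : ℝ) : Continuous (gNL p c) := by
  have : Continuous fun y : ℝ => |y| ^ (p - 1) :=
    continuous_abs.rpow_const fun _ => Or.inr (by linarith)
  unfold gNL
  fun_prop

lemma potNL_zero {p : ℝ} (hp : 1 < p) (c : ℝ) : potNL p c 0 = 0 := by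
  unfold potNL
  rw [abs_zero, Real.zero_rpow (by linarith)]
  simp

lemma gNL_eq_mul {p c y : ℝ} (hy : 0 ≤ y) : gNL p c y = y * (y ^ (p - 1) - c) := by
  unfold gNL
  rw [abs_of_nonneg hy]
  ring

lemma hasDerivAt_gNL {p c y : ℝ} (hy : 0 < y) :
    HasDerivAt (gNL p c) (p * y ^ (p - 1) - c) y := by
  have h : HasDerivAt (fun y : ℝ => y ^ p - c * y) (p * y ^ (p - 1) - c) y := by
    refine ((Real.hasDerivAt_rpow_const (p := p) (Or.inl hy.ne')).sub
      ((hasDerivAt_id y).const_mul c)).congr_deriv ?_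
    rw [mul_one]
  refine h.congr_of_eventuallyEq ?_
  filter_upwards [lt_mem_nhds hy] with z hz using gNL_of_pos hz

/-- The positive zero of `gNL p c`. -/
noncomputable def eqNL (p c : ℝ) : ℝ := c ^ (1 / (p - 1))

lemma eqNL_pos {p c : ℝ} (hc : 0 < c) : 0 < eqNL p c := Real.rpow_pos_of_pos hc _

lemma eqNL_rpow {p c : ℝ} (hp : 1 < p) (hc : 0 < c) : eqNL p c ^ (p - 1) = c := by
  unfold eqNL
  rw [← Real.rpow_mul hc.le, one_div_mul_cancel (by linarith), Real.rpow_one]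

lemma gNL_eqNL {p c : ℝ} (hp : 1 < p) (hc : 0 < c) : gNL p c (eqNL p c) = 0 := by
  rw [gNL_eq_mul (eqNL_pos hc).le, eqNL_rpow hp hc]
  ring

lemma gNL_neg {p c y : ℝ} (hp : 1 < p) (hc : 0 < c) (hy : 0 < y) (hyb : y < eqNL p c) :
    gNL p c y < 0 := by
  rw [gNL_eq_mul hy.le]
  have := Real.rpow_lt_rpow hy.le hyb (z := p - 1) (by linarith)
  rw [eqNL_rpow hp hc] at this
  exact mul_neg_of_pos_of_neg hy (by linarith)

lemma gNL_pos {p c y : ℝ} (hp : 1 < p) (hc : 0 < c) (hyb : eqNL p c < y) :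
    0 < gNL p c y := by
  have hb := eqNL_pos (p := p) hc
  rw [gNL_eq_mul (hb.trans hyb).le]
  have := Real.rpow_lt_rpow hb.le hyb (z := p - 1) (by linarith)
  rw [eqNL_rpow hp hc] at this
  exact mul_pos (hb.trans hyb) (by linarith)

lemma eq_eqNL_of_potNL_le {p c y : ℝ} (hp : 1 < p) (hc : 0 < c) (hy : 0 ≤ y)
    (h : potNL p c y ≤ potNL p c (eqNL p c)) : y = eqNL p c := by
  have hb := eqNL_pos (p := p) hc
  rcases lt_trichotomy y (eqNL p c) with hlt | heq | hgt
  · have hanti : StrictAntiOn (potNL p c) (Icc 0 (eqNL p c)) := by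
      refine strictAntiOn_of_deriv_neg (convex_Icc _ _) (continuous_potNL hp c).continuousOn ?_
      intro x hx
      rw [interior_Icc] at hx
      rw [(hasDerivAt_potNL hp c x).deriv]
      exact gNL_neg hp hc hx.1 hx.2
    exact absurd (hanti ⟨hy, hlt.le⟩ (right_mem_Icc.2 hb.le) hlt) (not_lt.2 h)
  · exact heq
  · have hmono : StrictMonoOn (potNL p c) (Ici (eqNL p c)) := by
      refine strictMonoOn_of_deriv_pos (convex_Ici _) (continuous_potNL hp c).continuousOn ?_
      intro x hx
      rw [interior_Ici] at hx
      rw [(hasDerivAt_potNL hp c x).deriv]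
      exact gNL_pos hp hc hx
    exact absurd (hmono self_mem_Ici hgt.le hgt) (not_lt.2 h)

lemma SolAt.monotoneOn_energyNL {p κ c a b : ℝ} {w w₁ w₂ : ℝ → ℝ} (hp : 1 < p) (hκ : κ < 1 / 2)
    (ha : 0 ≤ a) (h : ∀ x ∈ Icc a b, SolAt p κ c w w₁ w₂ x) :
    MonotoneOn (energyNL p c w w₁) (Icc a b) := by
  refine monotoneOn_of_hasDerivWithinAt_nonneg (convex_Icc a b)
    (fun x hx => ((h x hx).hasDerivAt_energyNL hp).continuousAt.continuousWithinAt)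
    (fun x hx => ((h x (interior_subset hx)).hasDerivAt_energyNL hp).hasDerivWithinAt) ?_
  intro x hx
  have := (interior_subset hx).1
  have : 0 ≤ x := by linarith
  have : 0 ≤ 1 - 2 * κ := by linarith
  positivity

lemma potNL_le_energyNL {p c x : ℝ} {w w₁ : ℝ → ℝ} (hx : 1 ≤ x) :
    potNL p c (w x) ≤ energyNL p c w w₁ x := by
  have : 0 ≤ x ^ 2 - 1 := by nlinarith
  have : 0 ≤ (x ^ 2 - 1) * w₁ x ^ 2 / 2 := by positivity
  unfold energyNL
  linarith

lemma SolAt.pos_of_energyNL_neg {p κ c a b : ℝ} {w w₁ w₂ : ℝ → ℝ} (hp : 1 < p) (hκ : κ < 1 / 2)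
    (ha : 1 ≤ a) (h : ∀ x ∈ Icc a b, SolAt p κ c w w₁ w₂ x) (hb : 0 < w b)
    (hE : energyNL p c w w₁ b < 0) : ∀ x ∈ Icc a b, 0 < w x := by
  intro x hx
  by_contra hneg
  have hc : ContinuousOn w (Icc x b) := fun y hy =>
    (h y ⟨hx.1.trans hy.1, hy.2⟩).d₁.continuousAt.continuousWithinAt
  obtain ⟨z, hz, hz0⟩ := intermediate_value_Icc hx.2 hc ⟨not_lt.1 hneg, hb.le⟩
  have hz' : z ∈ Icc a b := ⟨hx.1.trans hz.1, hz.2⟩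
  have h1 := SolAt.monotoneOn_energyNL hp hκ (by linarith) h hz' ⟨hx.1.trans hx.2, le_rfl⟩ hz.2
  have h2 := potNL_le_energyNL (p := p) (c := c) (w := w) (w₁ := w₁) (ha.trans hz'.1)
  rw [hz0, potNL_zero hp] at h2
  linarith

/-- A Lyapunov function for the long stretch where the energy is negative. -/
lemma SolAt.hasDerivAt_lyapunov {p κ c A x : ℝ} {w w₁ w₂ : ℝ → ℝ} (hp : 1 < p) (hx : 0 < x)
    (h : SolAt p κ c w w₁ w₂ x) (hw : 0 < w x) :
    HasDerivAt (fun x => A * energyNL p c w w₁ x - (x - x⁻¹) * (gNL p c (w x) * w₁ x))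
      ((A * (1 - 2 * κ) * (x * w₁ x) ^ 2
        - (1 + x⁻¹ ^ 2 - 2 * κ) * (gNL p c (w x) * (x * w₁ x))
        - (1 - x⁻¹ ^ 2) * ((p * w x ^ (p - 1) - c) * (x * w₁ x) ^ 2) + gNL p c (w x) ^ 2) / x) x := by
  have h1 : HasDerivAt (fun x : ℝ => x - x⁻¹) (1 + x⁻¹ ^ 2) x := by
    refine ((hasDerivAt_id x).sub (hasDerivAt_inv hx.ne')).congr_deriv ?_
    rw [inv_pow]; ring
  have h2 := ((h.hasDerivAt_energyNL hp).const_mul A).sub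
    (h1.mul ((((hasDerivAt_gNL (p := p) (c := c) hw).comp x h.d₁)).mul h.d₂))
  refine h2.congr_deriv ?_
  have e := h.eq
  simp only [Function.comp, Pi.mul_apply]
  have hx0 := hx.ne'
  set g := gNL p c (w x)
  set g' := p * w x ^ (p - 1) - c
  field_simp
  linear_combination -g * x * e

/-- On a long interval, the solution comes close to an equilibrium with small velocity. -/
lemma SolAt.exists_small {p κ c : ℝ} (hp : 1 < p) (hκ0 : 0 ≤ κ) (hκ : κ < 1 / 2) (hc : 0 < c)
    {W ε : ℝ} (hW0 : 0 < W) (hε0 : 0 < ε) :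
    ∃ X ≥ 2, ∀ w w₁ w₂ : ℝ → ℝ, ∀ x₁ ≥ X, (∀ x ∈ Icc 1 x₁, SolAt p κ c w w₁ w₂ x) →
      (∀ x ∈ Icc 1 x₁, energyNL p c w w₁ x ≤ 0) → (∀ x ∈ Icc 1 x₁, 0 < w x) →
      (∀ x ∈ Icc 1 x₁, w x ∈ Icc 0 W) →
      ∃ x₂ ∈ Icc 2 x₁, (x₂ * w₁ x₂) ^ 2 + gNL p c (w x₂) ^ 2 < ε := by
  obtain ⟨m, hm, hpot⟩ := exists_neg_le_potNL hp hc
  obtain ⟨Mg, hMg⟩ := (isCompact_Icc (a := 0) (b := W)).exists_bound_of_continuousOn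
    (continuous_gNL hp c).continuousOn
  set D := p * W ^ (p - 1) with hD
  have hD0 : 0 < D := by positivity
  have hκ1 : 0 < 1 - 2 * κ := by linarith
  set A := (3 + D) / (1 - 2 * κ) with hA
  have hA0 : 0 < A := by positivity
  set R := A * m + (3 * m + Mg ^ 2) / 2 with hR
  have hR0 : 0 < R := by positivity
  refine ⟨2 * Real.exp (4 * R / ε + 1), ?_, fun w w₁ w₂ x₁ hx₁ hsol hEneg hpos hwW => ?_⟩
  · have := Real.one_le_exp (x := 4 * R / ε + 1) (by positivity)
    linarith
  have hx₁2 : 2 ≤ x₁ := by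
    have := Real.one_le_exp (x := 4 * R / ε + 1) (by positivity)
    linarith
  by_contra! hcon
  let Φ : ℝ → ℝ := fun x => A * energyNL p c w w₁ x - (x - x⁻¹) * (gNL p c (w x) * w₁ x)
  have hmem : ∀ x ∈ Icc 2 x₁, x ∈ Icc 1 x₁ := fun x hx => ⟨by linarith [hx.1], hx.2⟩
  have hΦd := fun x (hx : x ∈ Icc 2 x₁) => (hsol x (hmem x hx)).hasDerivAt_lyapunov
    (A := A) hp (by linarith [hx.1]) (hpos x (hmem x hx))
  have hΦ : MonotoneOn (fun x => Φ x - ε / 2 * Real.log x) (Icc 2 x₁) := by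
    have hd := fun x (hx : x ∈ Icc 2 x₁) => (hΦd x hx).sub
      ((Real.hasDerivAt_log (by linarith [hx.1] : x ≠ 0)).const_mul (ε / 2))
    refine monotoneOn_of_hasDerivWithinAt_nonneg (convex_Icc _ _)
      (fun x hx => (hd x hx).continuousAt.continuousWithinAt)
      (fun x hx => (hd x (interior_subset hx)).hasDerivWithinAt) ?_
    intro x hx
    replace hx := interior_subset hx
    have hx2 := hx.1
    have hx0 : 0 < x := by linarith
    have hε' := hcon x hx
    have hg' : p * w x ^ (p - 1) - c ≤ D := by
      have h1 := hwW x (hmem x hx)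
      have : w x ^ (p - 1) ≤ W ^ (p - 1) :=
        Real.rpow_le_rpow h1.1 h1.2 (by linarith)
      have : p * w x ^ (p - 1) ≤ D := by rw [hD]; gcongr
      linarith
    have hA1 : A * (1 - 2 * κ) = 3 + D := by rw [hA]; field_simp
    rw [hA1]
    have hi : 0 ≤ x⁻¹ ^ 2 ∧ x⁻¹ ^ 2 ≤ 1 := by
      refine ⟨by positivity, ?_⟩
      have : x⁻¹ ≤ 1 := inv_le_one_of_one_le₀ (by linarith)
      exact pow_le_one₀ (by positivity) this
    set i := x⁻¹ ^ 2
    set q := x * w₁ x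
    set g := gNL p c (w x)
    have t1 : (1 - i) * ((p * w x ^ (p - 1) - c) * q ^ 2) ≤ D * q ^ 2 := by
      have s1 : (p * w x ^ (p - 1) - c) * q ^ 2 ≤ D * q ^ 2 := by gcongr
      have s2 : 0 ≤ D * q ^ 2 := by positivity
      have s3 : 0 ≤ 1 - i := by linarith
      nlinarith
    have t2 : (1 + i - 2 * κ) * (g * q) ≤ 2 * |g * q| := by
      refine (le_abs_self _).trans ?_
      rw [abs_mul]
      gcongr
      rw [abs_le]; constructor <;> linarith
    have t3 : 2 * |g * q| ≤ g ^ 2 / 2 + 2 * q ^ 2 := by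
      rw [abs_mul, ← sq_abs g, ← sq_abs q]
      nlinarith [sq_nonneg (|g| - 2 * |q|)]
    rw [← div_eq_mul_inv, ← sub_div]
    refine div_nonneg ?_ hx0.le
    nlinarith [sq_nonneg q]
  have hΦb : ∀ x ∈ Icc 2 x₁, |Φ x| ≤ R := by
    intro x hx
    have hx' := hmem x hx
    have hx2 := hx.1
    have hE1 := hEneg x hx'
    have hE2 : -m ≤ energyNL p c w w₁ x := (hpot _).trans (potNL_le_energyNL hx'.1)
    have hq : (x * w₁ x) ^ 2 ≤ 3 * m := by
      have h1 := hpot (w x)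
      unfold energyNL at hE1
      have h2 : (x ^ 2 - 1) * w₁ x ^ 2 ≤ 2 * m := by linarith
      have h3 : 3 / 4 * x ^ 2 ≤ x ^ 2 - 1 := by nlinarith
      have h4 : 3 / 4 * x ^ 2 * w₁ x ^ 2 ≤ (x ^ 2 - 1) * w₁ x ^ 2 := by gcongr
      nlinarith
    have hg := hMg _ (hwW x hx')
    rw [Real.norm_eq_abs] at hg
    have hgq : |(x - x⁻¹) * (gNL p c (w x) * w₁ x)| ≤ (3 * m + Mg ^ 2) / 2 := by
      have hi0 : 0 < x⁻¹ := by positivity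
      have hi1 : x⁻¹ ≤ x := (inv_le_one_of_one_le₀ (by linarith)).trans (by linarith)
      calc |(x - x⁻¹) * (gNL p c (w x) * w₁ x)|
          = (x - x⁻¹) * (|gNL p c (w x)| * |w₁ x|) := by
            rw [abs_mul, abs_mul, abs_of_nonneg (by linarith)]
        _ ≤ x * (|gNL p c (w x)| * |w₁ x|) := by gcongr; linarith
        _ = |gNL p c (w x)| * |x * w₁ x| := by
            rw [abs_mul, abs_of_pos (by linarith : 0 < x)]; ring
        _ ≤ (|x * w₁ x| ^ 2 + |gNL p c (w x)| ^ 2) / 2 := by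
            nlinarith [sq_nonneg (|gNL p c (w x)| - |x * w₁ x|)]
        _ ≤ (3 * m + Mg ^ 2) / 2 := by
            rw [sq_abs (x * w₁ x)]
            gcongr
    have hAE : |A * energyNL p c w w₁ x| ≤ A * m := by
      rw [abs_mul, abs_of_pos hA0]
      gcongr
      rw [abs_le]; constructor <;> linarith
    exact (abs_sub _ _).trans (add_le_add hAE hgq)
  have h1 := hΦ (left_mem_Icc.2 hx₁2) (right_mem_Icc.2 hx₁2) hx₁2
  have h2 := abs_le.1 (hΦb 2 (left_mem_Icc.2 hx₁2))
  have h3 := abs_le.1 (hΦb x₁ (right_mem_Icc.2 hx₁2))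
  have h4 : Real.log 2 + (4 * R / ε + 1) ≤ Real.log x₁ := by
    rw [← Real.log_exp (4 * R / ε + 1), ← Real.log_mul (by norm_num) (Real.exp_pos _).ne']
    exact Real.log_le_log (by positivity) hx₁
  simp only at h1
  have h5 : ε / 2 * (4 * R / ε + 1) ≤ 2 * R := by nlinarith
  have h6 : ε / 2 * (4 * R / ε + 1) = 2 * R + ε / 2 := by field_simp; ring
  linarith

/-- If the energy is below `-δ` at a far away point, the solution is close to the constant
solution on `[1, 2]`. -/
lemma SolAt.exists_near_eqNL {p κ c : ℝ} (hp : 1 < p) (hκ0 : 0 ≤ κ) (hκ : κ < 1 / 2) (hc : 0 < c)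
    {δ η : ℝ} (hδ : 0 < δ) (hη : 0 < η) :
    ∃ X ≥ 2, ∀ w w₁ w₂ : ℝ → ℝ, (∀ x ≥ 1, SolAt p κ c w w₁ w₂ x) → ∀ x₁ ≥ X, 0 < w x₁ →
      energyNL p c w w₁ x₁ ≤ -δ → ∀ x ∈ Icc (1 : ℝ) 2, |w x - eqNL p c| < η := by
  set b := eqNL p c with hb
  set W := ((p + 1) * c / 2) ^ (1 / (p - 1)) with hW
  have hW0 : 0 < W := by positivity
  obtain ⟨ε₁, hε₁, H₁⟩ := (isCompact_Icc (a := 0) (b := W)).exists_abs_sub_lt_of_lt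
    (f := fun y => potNL p c y - potNL p c b) (b := b)
    ((continuous_potNL hp c).sub continuous_const).continuousOn
    (fun y hy h => eq_eqNL_of_potNL_le hp hc hy.1 (sub_nonpos.1 h)) hη
  obtain ⟨η₂, hη₂, H₂⟩ := Metric.continuousAt_iff.1
    ((continuous_potNL hp c).continuousAt (x := b)) (ε₁ / 2) (by positivity)
  have hK : IsCompact (Icc 0 W ∩ {y | potNL p c y ≤ -δ}) :=
    isCompact_Icc.inter_right (isClosed_le (continuous_potNL hp c) continuous_const)
  obtain ⟨ε₂, hε₂, H₃⟩ := hK.exists_abs_sub_lt_of_lt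
    (f := fun y => gNL p c y ^ 2) (b := b)
    ((continuous_gNL hp c).pow 2).continuousOn
    (fun y hy h => by
      have hg : gNL p c y = 0 := by
        have : gNL p c y ^ 2 = 0 := le_antisymm h (sq_nonneg _)
        simpa using this
      rcases hy.1.1.eq_or_lt with h0 | h0
      · have := hy.2
        rw [← h0, mem_ofPred_eq, potNL_zero hp] at this
        linarith
      · rcases lt_trichotomy y b with hlt | heq | hgt
        · exact absurd hg (gNL_neg hp hc h0 hlt).ne
        · exact heq
        · exact absurd hg (gNL_pos hp hc hgt).ne') hη₂
  set ε := min ε₁ ε₂ with hε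
  have hε0 : 0 < ε := by positivity
  obtain ⟨X, hX, HX⟩ := SolAt.exists_small hp hκ0 hκ hc hW0 hε0
  refine ⟨X, hX, fun w w₁ w₂ hsol x₁ hx₁ hwx₁ hE => ?_⟩
  have hx₁2 : 2 ≤ x₁ := hX.le.trans hx₁
  have hsol' : ∀ x ∈ Icc 1 x₁, SolAt p κ c w w₁ w₂ x := fun x hx => hsol x hx.1
  have hmono := SolAt.monotoneOn_energyNL hp hκ zero_le_one hsol'
  have hEneg : ∀ x ∈ Icc 1 x₁, energyNL p c w w₁ x ≤ -δ := fun x hx =>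
    (hmono hx ⟨by linarith, le_rfl⟩ hx.2).trans hE
  have hpos := SolAt.pos_of_energyNL_neg hp hκ le_rfl hsol' hwx₁ (by linarith)
  have hG : ∀ x ∈ Icc 1 x₁, potNL p c (w x) ≤ -δ := fun x hx =>
    (potNL_le_energyNL hx.1).trans (hEneg x hx)
  have hwW : ∀ x ∈ Icc 1 x₁, w x ∈ Icc 0 W := by
    intro x hx
    refine ⟨(hpos x hx).le, ?_⟩
    by_contra h
    have := potNL_nonneg (y := w x) hp hc ((not_le.1 h).le.trans (le_abs_self _))
    linarith [hG x hx]
  obtain ⟨x₂, hx₂, hlt⟩ := HX w w₁ w₂ x₁ hx₁ hsol' (fun x hx => (hEneg x hx).trans (by linarith))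
    hpos hwW
  have hx₂' : x₂ ∈ Icc 1 x₁ := ⟨by linarith [hx₂.1], hx₂.2⟩
  have hclose : |w x₂ - b| < η₂ := by
    refine H₃ _ ⟨hwW _ hx₂', hG _ hx₂'⟩ ?_
    have := min_le_right ε₁ ε₂
    nlinarith [sq_nonneg (x₂ * w₁ x₂)]
  have hGb := abs_lt.1 (H₂ (x := w x₂) (by rwa [Real.dist_eq]))
  have hE₂ : energyNL p c w w₁ x₂ < potNL p c b + ε₁ := by
    have h1 := min_le_left ε₁ ε₂
    have h2 : (x₂ ^ 2 - 1) * w₁ x₂ ^ 2 ≤ (x₂ * w₁ x₂) ^ 2 := by nlinarith [sq_nonneg (w₁ x₂)]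
    unfold energyNL
    nlinarith [sq_nonneg (gNL p c (w x₂))]
  intro x hx
  have hx' : x ∈ Icc 1 x₁ := ⟨hx.1, hx.2.trans hx₁2⟩
  refine H₁ _ (hwW x hx') ?_
  have h1 := hmono hx' hx₂' (hx.2.trans hx₂.1)
  have h2 := potNL_le_energyNL (p := p) (c := c) (w := w) (w₁ := w₁) hx.1
  linarith

lemma abs_gNL_sub_le {p c : ℝ} (hp : 1 < p) (M : ℝ) :
    ∃ K > 0, ∀ y z, |y| ≤ M → |z| ≤ M → |gNL p c y - gNL p c z| ≤ K * |y - z| := by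
  have hpos : ∀ y z, 0 ≤ y → 0 ≤ z → y ≤ M → z ≤ M →
      |y ^ p - z ^ p| ≤ p * |M| ^ (p - 1) * |y - z| := by
    intro y z hy hz hyM hzM
    have := (convex_Icc 0 M).norm_image_sub_le_of_norm_hasDerivWithin_le
      (f := fun y => y ^ p) (f' := fun y => p * y ^ (p - 1)) (C := p * |M| ^ (p - 1))
      (fun x _ => (Real.hasDerivAt_rpow_const (Or.inr hp.le)).hasDerivWithinAt)
      (fun x hx => by
        rw [Real.norm_eq_abs, abs_of_nonneg (mul_nonneg (by linarith) (Real.rpow_nonneg hx.1 _))]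
        have : x ^ (p - 1) ≤ |M| ^ (p - 1) :=
          Real.rpow_le_rpow hx.1 (hx.2.trans (le_abs_self M)) (by linarith)
        gcongr)
      (⟨hz, hzM⟩ : z ∈ Icc 0 M) (⟨hy, hyM⟩ : y ∈ Icc 0 M)
    exact this
  have hrep : ∀ y : ℝ, |y| ^ (p - 1) * y = (max y 0) ^ p - (max (-y) 0) ^ p := by
    intro y
    rcases lt_trichotomy y 0 with h | h | h
    · rw [max_eq_right h.le, max_eq_left (by linarith), abs_of_neg h, Real.zero_rpow (by linarith),
        Real.rpow_sub_one (by linarith)]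
      have hy : y ≠ 0 := h.ne
      have : -y ≠ 0 := neg_ne_zero.2 hy
      field_simp
      ring
    · simp [h]
    · rw [max_eq_left h.le, max_eq_right (by linarith), abs_of_pos h, Real.zero_rpow (by linarith),
        Real.rpow_sub_one (by linarith)]
      field_simp
      ring
  have hD : 0 ≤ p * |M| ^ (p - 1) := by positivity
  refine ⟨2 * (p * |M| ^ (p - 1)) + |c| + 1, by positivity, fun y z hy hz => ?_⟩
  have hy' := abs_le.1 hy
  have hz' := abs_le.1 hz
  have hM : 0 ≤ M := (abs_nonneg y).trans hy
  have h1 := hpos (max y 0) (max z 0) (le_max_right _ _) (le_max_right _ _)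
    (max_le hy'.2 hM) (max_le hz'.2 hM)
  have h2 := hpos (max (-y) 0) (max (-z) 0) (le_max_right _ _) (le_max_right _ _)
    (max_le (by linarith) hM) (max_le (by linarith) hM)
  have h3 : |max y 0 - max z 0| ≤ |y - z| := abs_max_sub_max_le_abs y z 0
  have h4 : |max (-y) 0 - max (-z) 0| ≤ |y - z| := by
    have := abs_max_sub_max_le_abs (-y) (-z) 0
    rwa [neg_sub_neg, abs_sub_comm z y] at this
  have h5 : gNL p c y - gNL p c z = ((max y 0) ^ p - (max z 0) ^ p)
      - ((max (-y) 0) ^ p - (max (-z) 0) ^ p) - c * (y - z) := by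
    unfold gNL
    rw [hrep, hrep]
    ring
  rw [h5]
  have h6 := abs_sub (((max y 0) ^ p - (max z 0) ^ p)
      - ((max (-y) 0) ^ p - (max (-z) 0) ^ p)) (c * (y - z))
  have h7 := abs_sub ((max y 0) ^ p - (max z 0) ^ p) ((max (-y) 0) ^ p - (max (-z) 0) ^ p)
  rw [abs_mul] at h6
  have h8 := mul_le_mul_of_nonneg_left h3 hD
  have h9 := mul_le_mul_of_nonneg_left h4 hD
  nlinarith [abs_nonneg (y - z)]

/-- Growth estimate away from a singular point. -/
lemma abs_sub_le_of_singular {κ M x : ℝ} (hκ : 0 ≤ κ) (hx : 0 < x) {v v' : ℝ → ℝ}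
    (hv : ContinuousOn v (Icc 0 x)) (hd : ∀ s ∈ Ioo 0 x, HasDerivAt v (v' s) s)
    (hM : ∀ s ∈ Ioo 0 x, |s * v' s + κ * (v s - v 0)| ≤ M * s) : |v x - v 0| ≤ M * x := by
  obtain ⟨s, hs, he⟩ := exists_hasDerivAt_eq_slope (fun s => s ^ κ * (v s - v 0))
    (fun s => κ * s ^ (κ - 1) * (v s - v 0) + s ^ κ * v' s) hx
    ((Real.continuous_rpow_const hκ).continuousOn.mul (hv.sub continuousOn_const))
    (fun s hs => (Real.hasDerivAt_rpow_const (Or.inl hs.1.ne')).mul ((hd s hs).sub_const _))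
  have hs0 := hs.1
  have e1 : κ * s ^ (κ - 1) * (v s - v 0) + s ^ κ * v' s
      = s ^ κ * ((s * v' s + κ * (v s - v 0)) / s) := by
    rw [Real.rpow_sub_one hs0.ne']
    field_simp
    ring
  rw [sub_self, mul_zero, sub_zero, sub_zero, e1, eq_div_iff hx.ne'] at he
  have hk : |(s * v' s + κ * (v s - v 0)) / s| ≤ M := by
    rw [abs_div, abs_of_pos hs0, div_le_iff₀ hs0]
    exact hM s hs
  have hM0 : 0 ≤ M := (abs_nonneg _).trans hk
  have hxκ : 0 < x ^ κ := Real.rpow_pos_of_pos hx _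
  have hsx : s ^ κ ≤ x ^ κ := Real.rpow_le_rpow hs0.le hs.2.le hκ
  have h2 : x ^ κ * |v x - v 0| ≤ x ^ κ * (M * x) := by
    rw [← abs_of_pos hxκ, ← abs_mul, ← he, abs_mul, abs_mul, abs_of_pos hx,
      abs_of_pos (Real.rpow_pos_of_pos hs0 _), abs_of_pos hxκ]
    have : s ^ κ * |(s * v' s + κ * (v s - v 0)) / s| ≤ x ^ κ * M := by gcongr
    nlinarith
  exact le_of_mul_le_mul_left h2 hxκ

/-- Grönwall's inequality backwards in time. -/
lemma norm_le_gronwallBound_left {E : Type*} [NormedAddCommGroup E] [NormedSpace ℝ E]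
    {f f' : ℝ → E} {δ K ε a b : ℝ}
    (hf : ∀ x ∈ Icc a b, HasDerivWithinAt f (f' x) (Icc a b) x) (hb : ‖f b‖ ≤ δ)
    (bound : ∀ x ∈ Icc a b, ‖f' x‖ ≤ K * ‖f x‖ + ε) :
    ∀ x ∈ Icc a b, ‖f x‖ ≤ gronwallBound δ K ε (b - x) := by
  have hmem : ∀ s ∈ Icc (-b) (-a), -s ∈ Icc a b := fun s hs =>
    ⟨by linarith [hs.2], by linarith [hs.1]⟩
  have hd : ∀ s ∈ Icc (-b) (-a),
      HasDerivWithinAt (fun s => f (-s)) ((-1 : ℝ) • f' (-s)) (Icc (-b) (-a)) s := fun s hs =>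
    (hf (-s) (hmem s hs)).scomp s (hasDerivAt_neg s).hasDerivWithinAt hmem
  have h := norm_le_gronwallBound_of_norm_deriv_right_le (f := fun s => f (-s))
    (f' := fun s => (-1 : ℝ) • f' (-s)) (δ := δ) (K := K) (ε := ε) (a := -b) (b := -a)
    (fun s hs => (hd s hs).continuousWithinAt)
    (fun s hs => (hd s ⟨hs.1, hs.2.le⟩).mono_of_mem_nhdsWithin (Icc_mem_nhdsGE_of_mem hs))
    (by simpa using hb)
    (fun s hs => by simpa using bound (-s) (hmem s ⟨hs.1, hs.2.le⟩))
  intro x hx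
  have := h (-x) ⟨by linarith [hx.2], by linarith [hx.1]⟩
  simpa [add_comm, sub_eq_add_neg] using this

/-- A priori estimate: a solution of `(x² - 1) w'' + 2κ x w' + γ(w) = 0` which is close to a zero
of `γ` on `[1, 2]` stays close to it on `[0, 1]`. -/
lemma exists_apriori {κ K : ℝ} (hκ0 : 0 ≤ κ) (hκ : κ < 1 / 2) (hK : 0 < K) :
    ∃ C ≥ 1, ∀ (γ : ℝ → ℝ) (b η : ℝ) (w w₁ w₂ : ℝ → ℝ), γ b = 0 →
      (∀ y z, |γ y - γ z| ≤ K * |y - z|) →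
      (∀ x ∈ Icc (0 : ℝ) 2, HasDerivAt w (w₁ x) x ∧ HasDerivAt w₁ (w₂ x) x ∧
        (x ^ 2 - 1) * w₂ x + 2 * κ * x * w₁ x + γ (w x) = 0) →
      (∀ x ∈ Icc (1 : ℝ) 2, |w x - b| ≤ η) → ∀ x ∈ Icc (0 : ℝ) 1, |w x - b| ≤ C * η := by
  set h := 1 / (4 * (K + 1)) with hh
  have hh0 : 0 < h := by positivity
  have hh4 : h ≤ 1 / 4 := by
    rw [hh]
    apply one_div_le_one_div_of_le <;> linarith
  have hhK : (K + 1) * h = 1 / 4 := by rw [hh]; field_simp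
  refine ⟨5 / h * Real.exp ((1 + K) / h), ?_, ?_⟩
  · have h1 := Real.one_le_exp (x := (1 + K) / h) (by positivity)
    have h2 : 1 ≤ 5 / h := by rw [le_div_iff₀ hh0]; linarith
    exact one_le_mul_of_one_le_of_one_le h2 h1
  intro γ b η w w₁ w₂ hγb hγ hsol hη
  have hη0 : 0 ≤ η := (abs_nonneg _).trans (hη 1 ⟨le_rfl, by norm_num⟩)
  have hsub : ∀ x ∈ Icc (1 - h) (1 + h), x ∈ Icc (0 : ℝ) 2 := fun x hx =>
    ⟨by linarith [hx.1], by linarith [hx.2]⟩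
  have hc₁ : ContinuousOn w₁ (Icc (1 - h) (1 + h)) := fun x hx =>
    (hsol x (hsub x hx)).2.1.continuousAt.continuousWithinAt
  have h1mem : (1 : ℝ) ∈ Icc (1 - h) (1 + h) := ⟨by linarith, by linarith⟩
  obtain ⟨xm, hxm, hmax⟩ := isCompact_Icc.exists_isMaxOn ⟨1, h1mem⟩ hc₁.abs
  set S := |w₁ xm| with hS
  have hS' : ∀ x ∈ Icc (1 - h) (1 + h), |w₁ x| ≤ S := fun x hx => hmax hx
  have hS0 : 0 ≤ S := abs_nonneg _
  have hlip : ∀ x ∈ Icc (1 - h) (1 + h), ∀ y ∈ Icc (1 - h) (1 + h),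
      |w x - w y| ≤ S * |x - y| := fun x hx y hy =>
    (convex_Icc (1 - h) (1 + h)).norm_image_sub_le_of_norm_hasDerivWithin_le
      (f := w) (f' := w₁) (fun x hx => (hsol x (hsub x hx)).1.hasDerivWithinAt) hS' hy hx
  have hkey : ∀ s, 1 + s ∈ Icc (1 - h) (1 + h) →
      |s * w₂ (1 + s) + κ * (w₁ (1 + s) - w₁ 1)| ≤ (K + 1) * S * |s| := by
    intro s hs
    have e1 := (hsol (1 + s) (hsub _ hs)).2.2
    have e0 := (hsol 1 (hsub _ h1mem)).2.2
    have h2s : 1 ≤ 2 + s := by linarith [hs.1]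
    have e2 : (2 + s) * (s * w₂ (1 + s) + κ * (w₁ (1 + s) - w₁ 1))
        = -(κ * s * (w₁ (1 + s) + w₁ 1)) - (γ (w (1 + s)) - γ (w 1)) := by
      linear_combination e1 - e0
    have h3 : |γ (w (1 + s)) - γ (w 1)| ≤ K * (S * |s|) := by
      refine (hγ _ _).trans ?_
      have := hlip _ hs _ h1mem
      rw [add_sub_cancel_left] at this
      gcongr
    have h4 : |κ * s * (w₁ (1 + s) + w₁ 1)| ≤ S * |s| := by
      rw [abs_mul, abs_mul, abs_of_nonneg hκ0]
      have : |w₁ (1 + s) + w₁ 1| ≤ S + S :=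
        (abs_add_le _ _).trans (add_le_add (hS' _ hs) (hS' _ h1mem))
      calc κ * |s| * |w₁ (1 + s) + w₁ 1| ≤ 1 / 2 * |s| * (S + S) := by gcongr
        _ = S * |s| := by ring
    have h5 : |(2 + s) * (s * w₂ (1 + s) + κ * (w₁ (1 + s) - w₁ 1))| ≤ (K + 1) * S * |s| := by
      rw [e2]
      refine (abs_sub _ _).trans ?_
      rw [abs_neg]
      linarith
    rw [abs_mul, abs_of_pos (by linarith)] at h5
    nlinarith [abs_nonneg (s * w₂ (1 + s) + κ * (w₁ (1 + s) - w₁ 1))]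
  have hgrow : ∀ x ∈ Icc (1 - h) (1 + h), |w₁ x - w₁ 1| ≤ (K + 1) * S * |x - 1| := by
    intro x hx
    rcases lt_trichotomy x 1 with hlt | heq | hgt
    · have hmem : ∀ s ∈ Icc 0 (1 - x), 1 - s ∈ Icc (1 - h) (1 + h) := fun s hs =>
        ⟨by linarith [hs.2, hx.1], by linarith [hs.1]⟩
      have := abs_sub_le_of_singular (κ := κ) (M := (K + 1) * S) (x := 1 - x)
        (v := fun s => w₁ (1 - s)) (v' := fun s => -w₂ (1 - s)) hκ0 (by linarith)
        (hc₁.comp (by fun_prop) hmem)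
        (fun s hs => by
          have := (hsol (1 - s) (hsub _ (hmem s ⟨hs.1.le, hs.2.le⟩))).2.1.comp s
            ((hasDerivAt_id s).const_sub 1)
          rw [mul_neg, mul_one] at this
          exact this)
        (fun s hs => by
          have := hkey (-s) (by simpa [← sub_eq_add_neg] using hmem s ⟨hs.1.le, hs.2.le⟩)
          rw [abs_neg, abs_of_pos hs.1] at this
          simpa [← sub_eq_add_neg] using this)
      rw [abs_sub_comm x 1, abs_of_pos (by linarith : 0 < 1 - x)]
      simpa using this
    · simp [heq]
    · have hmem : ∀ s ∈ Icc 0 (x - 1), 1 + s ∈ Icc (1 - h) (1 + h) := fun s hs =>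
        ⟨by linarith [hs.1], by linarith [hs.2, hx.2]⟩
      have := abs_sub_le_of_singular (κ := κ) (M := (K + 1) * S) (x := x - 1)
        (v := fun s => w₁ (1 + s)) (v' := fun s => w₂ (1 + s)) hκ0 (by linarith)
        (hc₁.comp (by fun_prop) hmem)
        (fun s hs => by
          have := (hsol (1 + s) (hsub _ (hmem s ⟨hs.1.le, hs.2.le⟩))).2.1.comp s
            ((hasDerivAt_id s).const_add 1)
          rw [mul_one] at this
          exact this)
        (fun s hs => by
          have := hkey s (hmem s ⟨hs.1.le, hs.2.le⟩)
          rw [abs_of_pos hs.1] at this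
          simpa using this)
      rw [abs_of_pos (by linarith : 0 < x - 1)]
      simpa using this
  have hgrow' : ∀ x ∈ Icc (1 - h) (1 + h), |w₁ x - w₁ 1| ≤ S / 4 := by
    intro x hx
    have hx1 : |x - 1| ≤ h := by rw [abs_le]; constructor <;> linarith [hx.1, hx.2]
    calc |w₁ x - w₁ 1| ≤ (K + 1) * S * |x - 1| := hgrow x hx
      _ ≤ (K + 1) * S * h := by gcongr
      _ = S / 4 := by linear_combination S * hhK
  have hS1 : S ≤ 4 / 3 * |w₁ 1| := by
    have h1 := hgrow' xm hxm
    have h2 := abs_sub_abs_le_abs_sub (w₁ xm) (w₁ 1)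
    linarith
  have hv0 : |w₁ 1| * h ≤ 3 * η := by
    obtain ⟨ξ, hξ, hξe⟩ := exists_hasDerivAt_eq_slope w w₁ (a := 1) (b := 1 + h) (by linarith)
      (fun x hx => (hsol x ⟨by linarith [hx.1], by linarith [hx.2]⟩).1.continuousAt.continuousWithinAt)
      (fun x hx => (hsol x ⟨by linarith [hx.1], by linarith [hx.2]⟩).1)
    have h1 := hgrow' ξ ⟨by linarith [hξ.1], hξ.2.le⟩
    have h2 := abs_sub_abs_le_abs_sub (w₁ 1) (w₁ ξ)
    rw [abs_sub_comm] at h2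
    rw [eq_div_iff (by linarith), add_sub_cancel_left] at hξe
    have h3 : |w₁ ξ| * h ≤ 2 * η := by
      rw [← abs_of_pos hh0, ← abs_mul, hξe]
      have a1 := abs_le.1 (hη (1 + h) ⟨by linarith, by linarith⟩)
      have a2 := abs_le.1 (hη 1 ⟨le_rfl, by norm_num⟩)
      rw [abs_le]; constructor <;> linarith
    nlinarith
  have hSh : S * h ≤ 4 * η := by nlinarith
  have hnear : ∀ x ∈ Icc (1 - h) 1, |w x - b| ≤ 5 * η := by
    intro x hx
    have h1 := hlip x ⟨hx.1, by linarith [hx.2]⟩ 1 h1mem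
    have hx1 : |x - 1| ≤ h := by rw [abs_le]; constructor <;> linarith [hx.1, hx.2]
    have h2 : S * |x - 1| ≤ S * h := by gcongr
    have h3 := hη 1 ⟨le_rfl, by norm_num⟩
    have h4 := abs_sub_le (w x) (w 1) b
    linarith
  have hexp := Real.one_le_exp (x := (1 + K) / h) (by positivity)
  have h5h : 5 ≤ 5 / h := by rw [le_div_iff₀ hh0]; linarith
  intro x hx
  rcases le_total (1 - h) x with hxh | hxh
  · refine (hnear x ⟨hxh, hx.2⟩).trans ?_
    have : 5 * 1 ≤ 5 / h * Real.exp ((1 + K) / h) := by gcongr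
    nlinarith
  · have hb : ‖((w (1 - h) - b, w₁ (1 - h)) : ℝ × ℝ)‖ ≤ 5 / h * η := by
      rw [Prod.norm_def, Real.norm_eq_abs, Real.norm_eq_abs]
      refine max_le ((hnear _ ⟨le_rfl, by linarith⟩).trans (by gcongr)) ?_
      refine (hS' _ ⟨le_rfl, by linarith⟩).trans ?_
      rw [div_mul_eq_mul_div, le_div_iff₀ hh0]
      linarith
    have hG := norm_le_gronwallBound_left (a := 0) (b := 1 - h)
      (f := fun x => ((w x - b, w₁ x) : ℝ × ℝ)) (f' := fun x => ((w₁ x, w₂ x) : ℝ × ℝ))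
      (K := (1 + K) / h) (ε := 0)
      (fun x hx => (((hsol x ⟨hx.1, by linarith [hx.2]⟩).1.sub_const b).prodMk
        (hsol x ⟨hx.1, by linarith [hx.2]⟩).2.1).hasDerivWithinAt) hb ?_ x ⟨hx.1, hxh⟩
    · rw [gronwallBound_ε0] at hG
      have h1 : |w x - b| ≤ ‖((w x - b, w₁ x) : ℝ × ℝ)‖ := norm_fst_le ((w x - b, w₁ x) : ℝ × ℝ)
      refine h1.trans (hG.trans ?_)
      have : Real.exp ((1 + K) / h * (1 - h - x)) ≤ Real.exp ((1 + K) / h) := by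
        apply Real.exp_le_exp.2
        refine mul_le_of_le_one_right (by positivity) (by linarith [hx.1])
      calc 5 / h * η * Real.exp ((1 + K) / h * (1 - h - x))
          ≤ 5 / h * η * Real.exp ((1 + K) / h) := by gcongr
        _ = _ := by ring
    · intro x hx
      set Z := ‖((w x - b, w₁ x) : ℝ × ℝ)‖ with hZ
      have z1 : |w x - b| ≤ Z := norm_fst_le ((w x - b, w₁ x) : ℝ × ℝ)
      have z2 : |w₁ x| ≤ Z := norm_snd_le ((w x - b, w₁ x) : ℝ × ℝ)
      have hZ0 : 0 ≤ Z := norm_nonneg _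
      rw [add_zero, Prod.norm_def, Real.norm_eq_abs, Real.norm_eq_abs]
      have hq1 : 1 ≤ (1 + K) / h := by rw [le_div_iff₀ hh0]; linarith
      refine max_le (z2.trans (by nlinarith)) ?_
      have e := (hsol x ⟨hx.1, by linarith [hx.2]⟩).2.2
      have hx0 := hx.1
      have hxh' := hx.2
      have h1 : h * |w₂ x| ≤ (1 + K) * Z := by
        have a1 : h ≤ 1 - x ^ 2 := by nlinarith
        have a2 : (1 - x ^ 2) * w₂ x = 2 * κ * x * w₁ x + (γ (w x) - γ b) := by
          rw [hγb]; linarith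
        calc h * |w₂ x| ≤ (1 - x ^ 2) * |w₂ x| := by gcongr
          _ = |(1 - x ^ 2) * w₂ x| := by rw [abs_mul, abs_of_pos (by linarith : 0 < 1 - x ^ 2)]
          _ ≤ |2 * κ * x * w₁ x| + |γ (w x) - γ b| := by rw [a2]; exact abs_add_le _ _
          _ ≤ 1 * Z + K * Z := by
              gcongr
              · rw [abs_mul, abs_of_nonneg (by positivity : 0 ≤ 2 * κ * x)]
                gcongr
                nlinarith
              · exact (hγ _ _).trans (by gcongr)
          _ = _ := by ring
      rw [div_mul_eq_mul_div, le_div_iff₀ hh0]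
      linarith

/-- The point of `[l, u]` closest to `y`. -/
noncomputable def clip (l u y : ℝ) : ℝ := max (min y u) l

lemma abs_clip_sub_clip_le (l u y z : ℝ) : |clip l u y - clip l u z| ≤ |y - z| :=
  (abs_max_sub_max_le_abs _ _ _).trans <|
    (abs_min_sub_min_le_max y u z u).trans <| by simp

lemma clip_mem {l u : ℝ} (h : l ≤ u) (y : ℝ) : clip l u y ∈ Icc l u :=
  ⟨le_max_right _ _, max_le (min_le_right _ _) h⟩

lemma clip_of_mem {l u y : ℝ} (hy : y ∈ Icc l u) : clip l u y = y := by
  rw [clip, min_eq_left hy.2, max_eq_left hy.1]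

/-- The regular branch of the equation can be solved backwards up to `x = -1 / 2`. -/
lemma exists_sol_left {κ K B a y₀ v₀ : ℝ} (hκ0 : 0 ≤ κ) (hκ : κ < 1 / 2) (ha0 : 0 < a) (ha : a < 1)
    (hK : 0 ≤ K) {γ : ℝ → ℝ} (hγ : ∀ y z, |γ y - γ z| ≤ K * |y - z|) (hB : ∀ y, |γ y| ≤ B) :
    ∃ y v : ℝ → ℝ, y a = y₀ ∧ v a = v₀ ∧ ∀ t ∈ Icc (-(1 / 2)) a,
      HasDerivWithinAt y (v t) (Icc (-(1 / 2)) a) t ∧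
      HasDerivWithinAt v ((2 * κ * t * v t + γ (y t)) / (1 - t ^ 2)) (Icc (-(1 / 2)) a) t := by
  have hB0 : 0 ≤ B := (abs_nonneg _).trans (hB 0)
  set Q := 2 / (1 - a) with hQ
  have hQ0 : 0 < Q := div_pos two_pos (by linarith)
  have hpos : ∀ t ∈ Icc (-(1 / 2)) a, 0 < 1 - t ^ 2 := fun t ht => by nlinarith [ht.1, ht.2]
  have hdiv : ∀ t ∈ Icc (-(1 / 2)) a, ∀ m M : ℝ, |m| ≤ M → |m / (1 - t ^ 2)| ≤ Q * M := by
    intro t ht m M hm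
    have hM : 0 ≤ M := (abs_nonneg _).trans hm
    rw [abs_div, abs_of_pos (hpos t ht), div_le_iff₀ (hpos t ht)]
    have h1 : 1 ≤ Q * (1 - t ^ 2) := by
      rw [hQ, div_mul_eq_mul_div, le_div_iff₀ (by linarith)]
      nlinarith [ht.1, ht.2]
    nlinarith
  have h2κ : ∀ t ∈ Icc (-(1 / 2)) a, ∀ s, |2 * κ * t * s| ≤ |s| := by
    intro t ht s
    rw [abs_mul]
    have : |2 * κ * t| ≤ 1 := by
      rw [abs_le]; constructor <;> nlinarith [ht.1, ht.2]
    exact mul_le_of_le_one_left (abs_nonneg _) this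
  set V := gronwallBound |v₀| Q (Q * B) (a + 1 / 2) with hV
  have hmono := gronwallBound_mono (abs_nonneg v₀) (by positivity : 0 ≤ Q * B) hQ0.le
  have hV0 : |v₀| ≤ V := by
    have := hmono (by linarith : (0 : ℝ) ≤ a + 1 / 2)
    rwa [gronwallBound_x0] at this
  have hVV : -V ≤ V := by linarith [abs_nonneg v₀]
  have hcV : ∀ s, |clip (-V) V s| ≤ V := fun s => abs_le.2 (clip_mem hVV s)
  let f : ℝ → ℝ × ℝ → ℝ × ℝ := fun t z =>
    (clip (-V) V z.2, (2 * κ * t * clip (-V) V z.2 + γ z.1) / (1 - t ^ 2))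
  have hab : -(1 / 2) ≤ a := by linarith
  set R := V + Q * (V + B) with hR
  have hV0' : 0 ≤ V := (abs_nonneg _).trans hV0
  have hR0 : 0 ≤ R := by positivity
  have hpl : IsPicardLindelof f (tmin := -(1 / 2)) (tmax := a) ⟨a, hab, le_rfl⟩ (y₀, v₀)
      (2 * R.toNNReal) 0 R.toNNReal (1 + Q * (1 + K)).toNNReal := by
    refine ⟨fun t ht => LipschitzWith.lipschitzOnWith (LipschitzWith.of_dist_le_mul ?_), ?_, ?_, ?_⟩
    · intro z z'
      rw [Real.coe_toNNReal _ (by positivity), dist_eq_norm, dist_eq_norm]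
      set D := ‖z - z'‖ with hD
      have d1 : |z.1 - z'.1| ≤ D := norm_fst_le (z - z')
      have d2 : |z.2 - z'.2| ≤ D := norm_snd_le (z - z')
      have hD0 : 0 ≤ D := norm_nonneg _
      have d3 := (abs_clip_sub_clip_le (-V) V z.2 z'.2).trans d2
      rw [Prod.norm_def]
      refine max_le ?_ ?_
      · refine (show |clip (-V) V z.2 - clip (-V) V z'.2| ≤ _ from d3.trans ?_)
        have : 0 ≤ Q * (1 + K) * D := by positivity
        linarith
      · have e : (2 * κ * t * clip (-V) V z.2 + γ z.1) / (1 - t ^ 2)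
            - (2 * κ * t * clip (-V) V z'.2 + γ z'.1) / (1 - t ^ 2)
            = (2 * κ * t * (clip (-V) V z.2 - clip (-V) V z'.2) + (γ z.1 - γ z'.1))
              / (1 - t ^ 2) := by ring
        change |(2 * κ * t * clip (-V) V z.2 + γ z.1) / (1 - t ^ 2)
            - (2 * κ * t * clip (-V) V z'.2 + γ z'.1) / (1 - t ^ 2)| ≤ _
        rw [e]
        refine (hdiv t ht _ (D + K * D) ?_).trans (by linarith)
        refine (abs_add_le _ _).trans (add_le_add ((h2κ t ht _).trans d3) ((hγ _ _).trans ?_))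
        gcongr
    · intro z _
      exact continuousOn_const.prodMk (ContinuousOn.div (by fun_prop) (by fun_prop)
        fun t ht => (hpos t ht).ne')
    · intro t ht z _
      rw [Real.coe_toNNReal _ hR0, Prod.norm_def]
      refine max_le ?_ ?_
      · refine (show |clip (-V) V z.2| ≤ _ from (hcV _).trans ?_)
        have : 0 ≤ Q * (V + B) := by positivity
        linarith
      · change |(2 * κ * t * clip (-V) V z.2 + γ z.1) / (1 - t ^ 2)| ≤ _
        refine (hdiv t ht _ (V + B) ?_).trans (by linarith)
        exact (abs_add_le _ _).trans (add_le_add ((h2κ t ht _).trans (hcV _)) (hB _))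
    · have : max (a - a) (a - -(1 / 2)) ≤ 2 := max_le (by linarith) (by linarith)
      have h := mul_le_mul_of_nonneg_left this R.toNNReal.2
      simp only [NNReal.coe_mul, NNReal.coe_ofNat, NNReal.coe_zero, sub_zero]
      rw [mul_comm 2]
      exact h
  obtain ⟨Z, hZa, hZ⟩ := hpl.exists_eq_forall_mem_Icc_hasDerivWithinAt₀
  have hd1 : ∀ t ∈ Icc (-(1 / 2)) a,
      HasDerivWithinAt (fun t => (Z t).1) (clip (-V) V (Z t).2) (Icc (-(1 / 2)) a) t :=
    fun t ht => (hasFDerivAt_fst (p := Z t)).comp_hasDerivWithinAt t (hZ t ht)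
  have hd2 : ∀ t ∈ Icc (-(1 / 2)) a, HasDerivWithinAt (fun t => (Z t).2)
      ((2 * κ * t * clip (-V) V (Z t).2 + γ (Z t).1) / (1 - t ^ 2)) (Icc (-(1 / 2)) a) t :=
    fun t ht => (hasFDerivAt_snd (p := Z t)).comp_hasDerivWithinAt t (hZ t ht)
  have hclip_le : ∀ s, |clip (-V) V s| ≤ |s| := fun s => by
    have := abs_clip_sub_clip_le (-V) V s 0
    rwa [clip_of_mem (y := 0) ⟨by linarith, hV0'⟩, sub_zero, sub_zero] at this
  have hZV : ∀ t ∈ Icc (-(1 / 2)) a, clip (-V) V (Z t).2 = (Z t).2 := by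
    intro t ht
    have := norm_le_gronwallBound_left (K := Q) (ε := Q * B) (δ := |v₀|) hd2
      (by simp only at hZa; rw [hZa]; exact le_rfl)
      (fun t ht => by
        refine (hdiv t ht _ (|(Z t).2| + B) ?_).trans ?_
        · exact (abs_add_le _ _).trans (add_le_add ((h2κ t ht _).trans (hclip_le _)) (hB _))
        · rw [mul_add]; exact le_rfl) t ht
    exact clip_of_mem (abs_le.1 (this.trans (hmono (by linarith [ht.1]))))
  refine ⟨fun t => (Z t).1, fun t => (Z t).2, ?_, ?_, fun t ht => ?_⟩
  · simp only at hZa ⊢; rw [hZa]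
  · simp only at hZa ⊢; rw [hZa]
  · have h1 := hd1 t ht
    have h2 := hd2 t ht
    rw [hZV t ht] at h1 h2
    exact ⟨h1, h2⟩

lemma hasDerivAt_ite_lt {y y' w w' : ℝ → ℝ} {l a : ℝ} (hla : l < a)
    (hy : ∀ t ∈ Icc l a, HasDerivWithinAt y (y' t) (Icc l a) t)
    (hw : ∀ x ≥ a, HasDerivAt w (w' x) x) (h0 : y a = w a) (h1 : y' a = w' a) {x : ℝ}
    (hx : l < x) :
    HasDerivAt (fun x => if x < a then y x else w x) (if x < a then y' x else w' x) x := by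
  rcases lt_trichotomy x a with h | h | h
  · rw [if_pos h]
    refine ((hy x ⟨hx.le, h.le⟩).hasDerivAt (Icc_mem_nhds hx h)).congr_of_eventuallyEq ?_
    filter_upwards [Iio_mem_nhds h] with s hs
    exact if_pos hs
  · subst h
    rw [if_neg (lt_irrefl _)]
    have hl : HasDerivWithinAt (fun s => if s < x then y s else w s) (w' x) (Icc l x) x := by
      refine (h1 ▸ hy x ⟨hla.le, le_rfl⟩).congr_of_mem (fun s hs => ?_) ⟨hla.le, le_rfl⟩
      rcases hs.2.lt_or_eq with h | h
      · exact if_pos h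
      · rw [h, if_neg (lt_irrefl _), h0]
    have hr : HasDerivWithinAt (fun s => if s < x then y s else w s) (w' x) (Ici x) x :=
      (hw x le_rfl).hasDerivWithinAt.congr_of_mem (fun s hs => if_neg (not_lt.2 hs)) self_mem_Ici
    refine (hl.union hr).hasDerivAt ?_
    rw [Icc_union_Ici_eq_Ici hla.le]
    exact Ici_mem_nhds hla
  · rw [if_neg h.not_gt]
    refine (hw x h.le).congr_of_eventuallyEq ?_
    filter_upwards [Ioi_mem_nhds h] with s hs
    exact if_neg (not_lt.2 (le_of_lt hs))

lemma SolAt.eq_left {p κ c l a : ℝ} (hp : 1 < p) (hl : 0 ≤ l) (ha : a < 1)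
    {w w₁ w₂ W W₁ W₂ : ℝ → ℝ} (hw : ∀ x ∈ Icc l a, SolAt p κ c w w₁ w₂ x)
    (hW : ∀ x ∈ Icc l a, SolAt p κ c W W₁ W₂ x) (h0 : W a = w a) (h1 : W₁ a = w₁ a) :
    ∀ x ∈ Icc l a, W x = w x := by
  have hcont : ∀ {w w₁ w₂ : ℝ → ℝ}, (∀ x ∈ Icc l a, SolAt p κ c w w₁ w₂ x) →
      ContinuousOn (fun x => (w x, w₁ x)) (Icc l a) := fun hw x hx =>
    ((hw x hx).d₁.continuousAt.prodMk (hw x hx).d₂.continuousAt).continuousWithinAt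
  obtain ⟨M₁, hM₁⟩ := isCompact_Icc.exists_bound_of_continuousOn (hcont hw)
  obtain ⟨M₂, hM₂⟩ := isCompact_Icc.exists_bound_of_continuousOn (hcont hW)
  set M := max M₁ M₂
  obtain ⟨K, hK0, hK⟩ := abs_gNL_sub_le (c := c) hp M
  let f : ℝ → ℝ × ℝ → ℝ × ℝ := fun t z =>
    (z.2, (2 * κ * t * z.2 + gNL p c z.1) / (1 - t ^ 2))
  have hpos : ∀ t ∈ Icc l a, 0 < 1 - t ^ 2 := fun t ht => by nlinarith [ht.1, ht.2]
  have hd : ∀ {w w₁ w₂ : ℝ → ℝ}, (∀ x ∈ Icc l a, SolAt p κ c w w₁ w₂ x) → ∀ x ∈ Ioc l a,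
      HasDerivWithinAt (fun x => (w x, w₁ x)) (f x (w x, w₁ x)) (Iic x) x := by
    intro w w₁ w₂ hw x hx
    have h := hw x (Ioc_subset_Icc_self hx)
    have hp := hpos x (Ioc_subset_Icc_self hx)
    have e : (2 * κ * x * w₁ x + gNL p c (w x)) / (1 - x ^ 2) = w₂ x := by
      rw [div_eq_iff hp.ne']
      linarith [h.eq]
    change HasDerivWithinAt _ (w₁ x, (2 * κ * x * w₁ x + gNL p c (w x)) / (1 - x ^ 2)) _ _
    rw [e]
    exact (h.d₁.prodMk h.d₂).hasDerivWithinAt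
  have hlip : ∀ t ∈ Ioc l a, LipschitzOnWith
      (1 + (2 * |κ| + K) / (1 - a ^ 2)).toNNReal (f t) {z | ‖z‖ ≤ M} := by
    intro t ht
    have hta := hpos t (Ioc_subset_Icc_self ht)
    have haa := hpos a ⟨ht.1.le.trans ht.2, le_rfl⟩
    refine LipschitzOnWith.of_dist_le_mul fun z hz z' hz' => ?_
    rw [mem_ofPred_eq] at hz hz'
    rw [Real.coe_toNNReal _ (by positivity), dist_eq_norm, dist_eq_norm]
    set D := ‖z - z'‖ with hD
    have d1 : |z.1 - z'.1| ≤ D := norm_fst_le (z - z')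
    have d2 : |z.2 - z'.2| ≤ D := norm_snd_le (z - z')
    have hD0 : 0 ≤ D := norm_nonneg _
    have hq : 0 ≤ (2 * |κ| + K) / (1 - a ^ 2) * D := by positivity
    rw [Prod.norm_def]
    refine max_le (show |z.2 - z'.2| ≤ _ by linarith) ?_
    have e : (2 * κ * t * z.2 + gNL p c z.1) / (1 - t ^ 2)
        - (2 * κ * t * z'.2 + gNL p c z'.1) / (1 - t ^ 2)
        = (2 * κ * t * (z.2 - z'.2) + (gNL p c z.1 - gNL p c z'.1)) / (1 - t ^ 2) := by ring
    change |(2 * κ * t * z.2 + gNL p c z.1) / (1 - t ^ 2)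
        - (2 * κ * t * z'.2 + gNL p c z'.1) / (1 - t ^ 2)| ≤ _
    have hn : |2 * κ * t * (z.2 - z'.2) + (gNL p c z.1 - gNL p c z'.1)| ≤ (2 * |κ| + K) * D := by
      have h1 : |2 * κ * t * (z.2 - z'.2)| ≤ 2 * |κ| * D := by
        rw [abs_mul, abs_mul, abs_mul, abs_two]
        have : |t| ≤ 1 := abs_le.2 ⟨by linarith [ht.1], by linarith [ht.2]⟩
        calc 2 * |κ| * |t| * |z.2 - z'.2| ≤ 2 * |κ| * 1 * D := by gcongr
          _ = _ := by ring
      have h2 := hK z.1 z'.1 ((norm_fst_le z).trans hz) ((norm_fst_le z').trans hz')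
      have h3 : K * |z.1 - z'.1| ≤ K * D := by gcongr
      have h4 := abs_add_le (2 * κ * t * (z.2 - z'.2)) (gNL p c z.1 - gNL p c z'.1)
      linarith
    have hta' : 1 - a ^ 2 ≤ 1 - t ^ 2 := by nlinarith [ht.1, ht.2]
    have : |(2 * κ * t * (z.2 - z'.2) + (gNL p c z.1 - gNL p c z'.1)) / (1 - t ^ 2)|
        ≤ (2 * |κ| + K) / (1 - a ^ 2) * D := by
      rw [abs_div, abs_of_pos hta, div_mul_eq_mul_div]
      gcongr
    rw [e]
    linarith
  have h := ODE_solution_unique_of_mem_Icc_left hlip (hcont hW) (hd hW)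
    (fun t ht => (hM₂ t (Ioc_subset_Icc_self ht)).trans (le_max_right _ _)) (hcont hw) (hd hw)
    (fun t ht => (hM₁ t (Ioc_subset_Icc_self ht)).trans (le_max_left _ _))
    (by simp only [h0, h1])
  exact fun x hx => congrArg Prod.fst (h hx)

/-- A solution close to the constant equilibrium on `[1, 2]` extends to a solution on `(0, ∞)`
which is positive on `(0, 1]` and `C¹` up to `0`. -/
lemma SolAt.exists_extension {p κ c : ℝ} (hp : 1 < p) (hκ0 : 0 ≤ κ) (hκ : κ < 1 / 2) (hc : 0 < c) :
    ∃ η > 0, ∀ x₀ ∈ Ico (0 : ℝ) 1, ∀ w w₁ w₂ : ℝ → ℝ, (∀ x > x₀, SolAt p κ c w w₁ w₂ x) →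
      (∀ x ∈ Icc (1 : ℝ) 2, |w x - eqNL p c| < η) →
      ∃ W W₁ W₂ : ℝ → ℝ, (∀ x > x₀, W x = w x) ∧ (∀ x > 0, SolAt p κ c W W₁ W₂ x) ∧
        (∀ x ∈ Icc (0 : ℝ) 1, 0 < W x) ∧ ContinuousAt W 0 ∧ ContinuousAt W₁ 0 := by
  set b := eqNL p c with hb
  have hb0 : 0 < b := eqNL_pos hc
  obtain ⟨K, hK, hKlip⟩ := abs_gNL_sub_le (c := c) hp (3 * b / 2)
  have hbb : b / 2 ≤ 3 * b / 2 := by linarith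
  set γ : ℝ → ℝ := fun y => gNL p c (clip (b / 2) (3 * b / 2) y) with hγdef
  have hclip : ∀ y, |clip (b / 2) (3 * b / 2) y| ≤ 3 * b / 2 := fun y => by
    have := clip_mem hbb y
    rw [abs_le]; constructor <;> linarith [this.1, this.2]
  have hγ : ∀ y z, |γ y - γ z| ≤ K * |y - z| := fun y z =>
    (hKlip _ _ (hclip y) (hclip z)).trans (mul_le_mul_of_nonneg_left (abs_clip_sub_clip_le _ _ _ _) hK.le)
  have hγeq : ∀ y, |y - b| ≤ b / 2 → γ y = gNL p c y := fun y hy => by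
    have := abs_le.1 hy
    rw [hγdef]
    simp only
    rw [clip_of_mem ⟨by linarith, by linarith⟩]
  have hγb : γ b = 0 := by
    rw [hγeq b (by simp; positivity), hb, gNL_eqNL hp hc]
  have hγB : ∀ y, |γ y| ≤ K * (3 * b) := fun y => by
    have h1 := hKlip _ b (hclip y) (by rw [abs_of_pos hb0]; linarith)
    rw [hb, gNL_eqNL hp hc, sub_zero, ← hb] at h1
    have h2 := abs_sub (clip (b / 2) (3 * b / 2) y) b
    rw [abs_of_pos hb0] at h2
    exact h1.trans (by gcongr; linarith [hclip y])
  obtain ⟨C, hC, hapr⟩ := exists_apriori hκ0 hκ hK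
  have hη0 : 0 < b / (4 * C) := by positivity
  have hη4 : b / (4 * C) ≤ b / 4 := by gcongr; linarith
  have hCη : C * (b / (4 * C)) = b / 4 := by field_simp
  refine ⟨b / (4 * C), hη0, fun x₀ hx₀ w w₁ w₂ hw hnear => ?_⟩
  have hw1 := hnear 1 ⟨le_rfl, by norm_num⟩
  obtain ⟨ε, hε, hεw⟩ := Metric.eventually_nhds_iff.1
    (((hw 1 hx₀.2).d₁.continuousAt.sub_const b).abs.eventually_lt_const
      (show |w 1 - b| < b / 2 by linarith))
  set a := max ((1 + x₀) / 2) (1 - ε / 2) with ha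
  have ha1 : a < 1 := max_lt (by linarith [hx₀.2]) (by linarith)
  have hax : x₀ < a := lt_of_lt_of_le (by linarith [hx₀.2]) (le_max_left _ _)
  have haε : 1 - ε / 2 ≤ a := le_max_right _ _
  have ha0 : 0 < a := hx₀.1.trans_lt hax
  have hwa : ∀ x ∈ Icc a 2, |w x - b| ≤ b / 2 := by
    intro x hx
    rcases le_total 1 x with h1 | h1
    · exact (hnear x ⟨h1, hx.2⟩).le.trans (by linarith)
    · refine (hεw ?_).le
      rw [Real.dist_eq, abs_lt]
      constructor <;> linarith [hx.1]
  obtain ⟨y, v, hya, hva, hyv⟩ := exists_sol_left (y₀ := w a) (v₀ := w₁ a) hκ0 hκ ha0 ha1 hK.le hγ hγB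
  have hla : -(1 / 2) < a := by linarith
  set v' : ℝ → ℝ := fun t => (2 * κ * t * v t + γ (y t)) / (1 - t ^ 2) with hv'
  have hv'eq : ∀ x, 0 ≤ x → x ≤ a → (x ^ 2 - 1) * v' x + 2 * κ * x * v x + γ (y x) = 0 := by
    intro x hx0 hxa
    have : 1 - x ^ 2 ≠ 0 := by nlinarith
    rw [hv']
    field_simp
    ring
  have hv'a : v' a = w₂ a := by
    have h1 := hv'eq a ha0.le le_rfl
    have h2 := (hw a hax).eq
    rw [hya, hva, hγeq _ (hwa a ⟨le_rfl, by linarith⟩)] at h1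
    have h3 : a ^ 2 - 1 ≠ 0 := by nlinarith
    exact mul_left_cancel₀ h3 (by linarith)
  set W : ℝ → ℝ := fun x => if x < a then y x else w x with hW
  set W₁ : ℝ → ℝ := fun x => if x < a then v x else w₁ x with hW₁
  set W₂ : ℝ → ℝ := fun x => if x < a then v' x else w₂ x with hW₂
  have hd₁ : ∀ x > -(1 / 2), HasDerivAt W (W₁ x) x := fun x hx =>
    hasDerivAt_ite_lt hla (fun t ht => (hyv t ht).1) (fun x hx => (hw x (hax.trans_le hx)).d₁)
      hya hva hx
  have hd₂ : ∀ x > -(1 / 2), HasDerivAt W₁ (W₂ x) x := fun x hx =>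
    hasDerivAt_ite_lt hla (fun t ht => (hyv t ht).2) (fun x hx => (hw x (hax.trans_le hx)).d₂)
      hva hv'a hx
  have heqγ : ∀ x ∈ Icc (0 : ℝ) 2, (x ^ 2 - 1) * W₂ x + 2 * κ * x * W₁ x + γ (W x) = 0 := by
    intro x hx
    rcases lt_or_ge x a with h | h
    · simp only [hW, hW₁, hW₂, if_pos h]
      exact hv'eq x hx.1 h.le
    · simp only [hW, hW₁, hW₂, if_neg (not_lt.2 h)]
      rw [hγeq _ (hwa x ⟨h, hx.2⟩)]
      exact (hw x (hax.trans_le h)).eq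
  have hWw : ∀ x ≥ a, W x = w x := fun x hx => if_neg (not_lt.2 hx)
  have hclose : ∀ x ∈ Icc (0 : ℝ) 1, |W x - b| ≤ b / 4 := by
    have := hapr γ b (b / (4 * C)) W W₁ W₂ hγb hγ
      (fun x hx => ⟨hd₁ x (by linarith [hx.1]), hd₂ x (by linarith [hx.1]), heqγ x hx⟩)
      (fun x hx => by rw [hWw x (by linarith [hx.1])]; exact (hnear x hx).le)
    rwa [hCη] at this
  have hsol : ∀ x > 0, SolAt p κ c W W₁ W₂ x := by
    intro x hx
    refine ⟨hd₁ x (by linarith), hd₂ x (by linarith), ?_⟩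
    rcases lt_or_ge x a with h | h
    · have h1 := heqγ x ⟨hx.le, by linarith⟩
      rwa [hγeq _ ((hclose x ⟨hx.le, by linarith⟩).trans (by linarith))] at h1
    · simp only [hW, hW₁, hW₂, if_neg (not_lt.2 h)]
      exact (hw x (hax.trans_le h)).eq
  refine ⟨W, W₁, W₂, fun x hx => ?_, hsol, fun x hx => ?_,
    (hd₁ 0 (by norm_num)).continuousAt, (hd₂ 0 (by norm_num)).continuousAt⟩
  · rcases le_total a x with h | h
    · exact hWw x h
    · have hx0 : 0 < x := hx₀.1.trans_lt hx
      exact SolAt.eq_left hp hx0.le ha1 (fun s hs => hw s (hx.trans_le hs.1))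
        (fun s hs => hsol s (hx0.trans_le hs.1)) (hWw a le_rfl) (if_neg (lt_irrefl _)) x
        ⟨le_rfl, h⟩
  · have := abs_le.1 (hclose x hx)
    linarith

lemma kelvin_kelvin (α : ℝ) (f : ℝ → ℝ) {x : ℝ} (hx : 0 < x) : kelvin α (kelvin α f) x = f x := by
  rw [kelvin, kelvin, inv_inv, Real.inv_rpow hx.le, Real.rpow_neg hx.le, inv_inv, ← mul_assoc,
    inv_mul_cancel₀ (Real.rpow_pos_of_pos hx _).ne', one_mul]

lemma kelvin_pos {α : ℝ} {f : ℝ → ℝ} {x : ℝ} (hx : 0 < x) (hf : 0 < f x⁻¹) : 0 < kelvin α f x :=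
  mul_pos (Real.rpow_pos_of_pos hx _) hf

lemma analyticAt_kelvin {α : ℝ} {f : ℝ → ℝ} {x : ℝ} (hx : 0 < x) (hf : AnalyticAt ℝ f x⁻¹) :
    AnalyticAt ℝ (kelvin α f) x :=
  ((Real.contDiffAt_rpow_const_of_ne (n := ⊤) hx.ne').analyticAt).mul
    (hf.comp (analyticAt_inv hx.ne'))

lemma exists_global_kelvin {p κ α : ℝ} (hp : 1 < p) (hα : 0 < α) (hαp : α * (p - 1) = 2)
    (hκ0 : 0 ≤ κ) (hκ : κ < 1 / 2) :
    ∃ C > 0, ∀ σ > 1, ∀ u u₁ u₂ : ℝ → ℝ, ContinuousOn u (Ico 0 σ) →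
      ContinuousOn u₁ (Ico 0 σ) → u₁ 0 = 0 → (∀ ρ ∈ Ioo 0 σ, ProfAt p κ α u u₁ u₂ ρ) →
      C ≤ u 0 → ∃ W W₁ W₂ : ℝ → ℝ, (∀ ρ ∈ Ioo 0 σ, kelvin α W ρ = u ρ) ∧
        (∀ x > 0, SolAt p κ (α * (α + 1 - 2 * κ)) W W₁ W₂ x) ∧ (∀ x ≥ 0, 0 < W x) ∧
        ContinuousAt W 0 ∧ ContinuousAt W₁ 0 := by
  have hc : 0 < α * (α + 1 - 2 * κ) := mul_pos hα (by linarith)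
  obtain ⟨η, hη, hext⟩ := SolAt.exists_extension hp hκ0 hκ hc
  obtain ⟨δ, hδ, hen⟩ := exists_energy_le hp hα hαp hκ
  obtain ⟨X, hX, hnear⟩ := SolAt.exists_near_eqNL hp hκ0 hκ hc hδ hη
  obtain ⟨C, hC, hen⟩ := hen X
  refine ⟨C, hC, fun σ hσ u u₁ u₂ hu hu₁ hu₁0 hsol hCu => ?_⟩
  have hσ0 : 0 < σ := by linarith
  obtain ⟨x₁, hx₁, hwpos, hE⟩ := hen σ hσ u u₁ u₂ hu hu₁ hu₁0 hsol hCu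
  have hσ1 : σ⁻¹ < 1 := inv_lt_one_of_one_lt₀ hσ
  have hw : ∀ x > σ⁻¹, SolAt p κ (α * (α + 1 - 2 * κ)) (kelvin α u) (kelvin₁ α u u₁)
      (kelvin₂ α u u₁ u₂) x := fun x hx => by
    have hx0 : 0 < x := (inv_pos.2 hσ0).trans hx
    exact ProfAt.kelvin hαp hx0 (hsol x⁻¹ ⟨inv_pos.2 hx0, inv_lt_of_inv_lt₀ hσ0 hx⟩)
  have hpos := SolAt.pos_of_energyNL_neg hp hκ le_rfl
    (fun x hx => hw x (hσ1.trans_le (mem_Icc.1 hx).1)) (hwpos x₁ le_rfl) (by linarith)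
  obtain ⟨W, W₁, W₂, hWw, hW, hWpos, hW0, hW₁0⟩ := hext σ⁻¹ ⟨(inv_pos.2 hσ0).le, hσ1⟩ _ _ _ hw
    (hnear _ _ _ (fun x hx => hw x (hσ1.trans_le hx)) x₁ hx₁ (hwpos x₁ le_rfl) hE)
  refine ⟨W, W₁, W₂, fun ρ hρ => ?_, hW, fun x hx => ?_, hW0, hW₁0⟩
  · rw [← kelvin_kelvin α u hρ.1, kelvin, hWw _ (inv_strictAnti₀ hρ.1 hρ.2)]
    rfl
  · rcases le_total x 1 with h | h
    · exact hWpos x ⟨hx, h⟩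
    · rw [hWw x (hσ1.trans_le h)]
      rcases le_total x x₁ with h' | h'
      · exact hpos x ⟨h, h'⟩
      · exact hwpos x h'

lemma tendsto_mul_kelvin {α : ℝ} {W : ℝ → ℝ} (hW : ContinuousAt W 0) :
    Tendsto (fun ρ => ρ ^ α * kelvin α W ρ) atTop (nhds (W 0)) := by
  refine (hW.tendsto.comp tendsto_inv_atTop_zero).congr' ?_
  filter_upwards [eventually_gt_atTop 0] with ρ hρ
  rw [kelvin, Real.rpow_neg hρ.le, ← mul_assoc, mul_inv_cancel₀ (Real.rpow_pos_of_pos hρ _).ne',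
    one_mul]
  rfl

lemma tendsto_mul_kelvin₁ {α : ℝ} {W W₁ : ℝ → ℝ} (hW : ContinuousAt W 0)
    (hW₁ : ContinuousAt W₁ 0) :
    Tendsto (fun ρ => ρ ^ (α + 1) * kelvin₁ α W W₁ ρ) atTop (nhds (-α * W 0)) := by
  have h1 : ContinuousAt (fun x => -α * W x - x * W₁ x) 0 :=
    (continuousAt_const.mul hW).sub (continuousAt_id.mul hW₁)
  have h2 := h1.tendsto.comp tendsto_inv_atTop_zero
  rw [zero_mul, sub_zero] at h2
  refine h2.congr' ?_
  filter_upwards [eventually_gt_atTop 0] with ρ hρ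
  rw [kelvin₁_eq α W W₁ hρ, Real.rpow_neg hρ.le, Real.rpow_add hρ, Real.rpow_one]
  have := (Real.rpow_pos_of_pos hρ α).ne'
  simp only [Function.comp]
  field_simp

theorem stmt2 (N : ℕ) (p : ℝ) (hN : 3 ≤ N)
    (hp1 : 1 + 4 / ((N : ℝ) - 2) < p)
    (hp2 : N = 3 ∨ p ≤ 1 + 4 / ((N : ℝ) - 3)) :
    ∃ C > 0, ∀ σ : ℝ, 1 < σ → ∀ u : ℝ → ℝ,
      ContDiffOn ℝ 2 u (Ico 0 σ) → IsSolOn N p u (Ioo 0 σ) → C ≤ u 0 →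
      (∀ x ∈ Ico (0 : ℝ) σ, 0 < u x) ∧
      ∃ v : ℝ → ℝ,
        (∀ x ∈ Ico (0 : ℝ) σ, v x = u x) ∧
        AnalyticOn ℝ v (Ioi 0) ∧
        (∀ x ∈ Ioi (0 : ℝ), 0 < v x) ∧
        IsSolOn N p v (Ioi 0) ∧
        ∃ L > 0,
          Tendsto (fun ρ => ρ ^ alphaP p * v ρ) atTop (nhds L) ∧
          Tendsto (fun ρ => ρ ^ (alphaP p + 1) * deriv v ρ) atTop
            (nhds (-(alphaP p) * L)) := by
  have hN' : (3 : ℝ) ≤ N := by exact_mod_cast hN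
  have hN2 : (0 : ℝ) < N - 2 := by linarith
  have hp4 : 4 / ((N : ℝ) - 2) < p - 1 := by linarith
  have hp0 : 0 < p - 1 := (div_pos four_pos hN2).trans hp4
  have hp : 1 < p := by linarith
  have hα : 0 < alphaP p := div_pos two_pos hp0
  have hαp : alphaP p * (p - 1) = 2 := div_mul_cancel₀ _ hp0.ne'
  obtain ⟨κ, hκ⟩ : ∃ κ : ℝ, (N : ℝ) - 1 = 2 * alphaP p + 2 - 2 * κ :=
    ⟨(2 * alphaP p + 3 - N) / 2, by ring⟩
  have hκ1 : κ < 1 / 2 := by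
    rw [div_lt_iff₀ hN2] at hp4
    have : 2 * alphaP p < N - 2 := by
      refine lt_of_mul_lt_mul_right ?_ hp0.le
      linarith
    linarith
  have hκ0 : 0 ≤ κ := by
    rcases hp2 with h | h
    · rw [h] at hκ
      norm_num at hκ
      linarith
    · rcases eq_or_lt_of_le hN' with h3 | h3
      · linarith
      · have h4 : p - 1 ≤ 4 / ((N : ℝ) - 3) := by linarith
        rw [le_div_iff₀ (by linarith)] at h4
        have : (N : ℝ) - 3 ≤ 2 * alphaP p := by
          refine le_of_mul_le_mul_right ?_ hp0
          linarith
        linarith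
  obtain ⟨C, hC, hglob⟩ := exists_global_kelvin hp hα hαp hκ0 hκ1
  refine ⟨C, hC, fun σ hσ u hu hsol hCu => ?_⟩
  have hσ0 : 0 < σ := by linarith
  simp only [IsSolOn, hκ] at hsol ⊢
  obtain ⟨u₁, u₂, hu₁, hu₁0, hprof⟩ := exists_profAt hσ0 (by linarith) hu hsol hp
  obtain ⟨W, W₁, W₂, hWu, hW, hWpos, hW0, hW₁0⟩ :=
    hglob σ hσ u u₁ u₂ hu.continuousOn hu₁ hu₁0 hprof hCu
  have hkpos : ∀ ρ > 0, 0 < kelvin (alphaP p) W ρ := fun ρ hρ =>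
    kelvin_pos hρ (hWpos _ (inv_pos.2 hρ).le)
  have hpr : ∀ ρ > 0, ProfAt p κ (alphaP p) (kelvin (alphaP p) W) (kelvin₁ (alphaP p) W W₁)
      (kelvin₂ (alphaP p) W W₁ W₂) ρ := fun ρ hρ => (hW _ (inv_pos.2 hρ)).kelvin hαp hρ
  set v : ℝ → ℝ := fun ρ => if ρ ≤ 0 then u ρ else kelvin (alphaP p) W ρ with hv
  have hvk : ∀ ρ > 0, v ρ = kelvin (alphaP p) W ρ := fun ρ hρ => if_neg (not_le.2 hρ)
  have hvd : ∀ ρ > 0, deriv v ρ = kelvin₁ (alphaP p) W W₁ ρ := fun ρ hρ =>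
    ((hpr ρ hρ).d₁.congr_of_eventuallyEq
      (eventually_of_mem (Ioi_mem_nhds hρ) hvk)).deriv
  have hvdd : ∀ ρ > 0, deriv (deriv v) ρ = kelvin₂ (alphaP p) W W₁ W₂ ρ := fun ρ hρ =>
    ((hpr ρ hρ).d₂.congr_of_eventuallyEq
      (eventually_of_mem (Ioi_mem_nhds hρ) hvd)).deriv
  have hux : ∀ x ∈ Ico 0 σ, 0 < u x := by
    intro x hx
    rcases hx.1.eq_or_lt with rfl | h
    · linarith
    · rw [← hWu x ⟨h, hx.2⟩]
      exact hkpos x h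
  refine ⟨hux, v, fun x hx => ?_, fun x hx => ?_, fun x hx => ?_, fun x hx => ?_,
    W 0, hWpos 0 le_rfl, ?_, ?_⟩
  · rcases hx.1.eq_or_lt with rfl | h
    · exact if_pos le_rfl
    · rw [hvk x h, hWu x ⟨h, hx.2⟩]
  · have hx' : 0 < x⁻¹ := inv_pos.2 hx
    have h1 : AnalyticAt ℝ W x⁻¹ := analyticAt_of_solAt hκ0 hx'
      (eventually_of_mem (Ioi_mem_nhds hx') hW) (hWpos _ hx'.le)
    exact ((analyticAt_kelvin hx h1).congr
      (eventually_of_mem (Ioi_mem_nhds hx) fun y hy => (hvk y hy).symm)).analyticWithinAt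
  · rw [hvk x hx]
    exact hkpos x hx
  · rw [hvk x hx, hvd x hx, hvdd x hx]
    exact (hpr x hx).eq
  · refine (tendsto_mul_kelvin (α := alphaP p) hW0).congr' ?_
    filter_upwards [eventually_gt_atTop 0] with ρ hρ
    rw [hvk ρ hρ]
  · refine (tendsto_mul_kelvin₁ (α := alphaP p) hW0 hW₁0).congr' ?_
    filter_upwards [eventually_gt_atTop 0] with ρ hρ
    rw [hvd ρ hρ]
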